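/- arXiv:1506.06624 — 3 statements merged into one kernel-verified Lean document; each statement's English description precedes it below -/
import Mathlib

section
/- If B₁ and B₂ are disjoint Borel sets with 0 ∉ closure(B₁) ∪ closure(B₂), then the jump processes X_t(B₁) := Σ_{s≤t} ΔX_s·1_{ΔX_s ∈ B₁} and X_t(B₂) are independent Lévy processes. -/
open MeasureTheory ProbabilityTheory Complex Filter Topology
open scoped RealInnerProductSpace

noncomputable section

/-- An `ℝⁿ`-valued Lévy process: `X₀ = 0` a.s., stationary increments that are
independent of the past, and continuity in probability. -/
structure IsLevyProcess {Ω : Type*} [MeasurableSpace Ω] (P : Measure Ω) {n : ℕ}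
    (X : ℝ → Ω → EuclideanSpace ℝ (Fin n)) : Prop where
  isProb : IsProbabilityMeasure P
  meas : ∀ t : ℝ, Measurable (X t)
  init : ∀ᵐ ω ∂P, X 0 ω = 0
  indep : ∀ s t : ℝ, 0 ≤ s → 0 ≤ t →
    IndepFun (fun ω => X (t + s) ω - X t ω)
      (fun ω => (fun r : {r : ℝ // 0 ≤ r ∧ r ≤ t} => X r ω)) P
  stat : ∀ s t : ℝ, 0 ≤ s → 0 ≤ t →
    Measure.map (fun ω => X (t + s) ω - X t ω) P = Measure.map (X s) P
  contProb : ∀ t : ℝ, 0 ≤ t → ∀ ε : ℝ, 0 < ε →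
    Tendsto (fun s : ℝ => P {ω | ε ≤ ‖X s ω - X t ω‖}) (𝓝[Set.Ici 0] t) (𝓝 0)

/-- The characteristic function `φ_t(u) = E[exp(i⟨u, X_t⟩)]`. -/
def charFn {Ω : Type*} [MeasurableSpace Ω] (P : Measure Ω) {n : ℕ}
    (X : ℝ → Ω → EuclideanSpace ℝ (Fin n)) (t : ℝ) (u : EuclideanSpace ℝ (Fin n)) : ℂ :=
  ∫ ω, Complex.exp (Complex.I * (⟪u, X t ω⟫ : ℝ)) ∂P


section Path

variable {E : Type*} [NormedAddCommGroup E]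

/-- Paths that are right-continuous on `[0, ∞)` and have left limits on `(0, ∞)`. -/
def IsCadlag (z : ℝ → E) : Prop :=
  (∀ t, 0 ≤ t → ContinuousWithinAt z (Set.Ici t) t) ∧
    ∀ t, 0 < t → ∃ l, Tendsto z (𝓝[<] t) (𝓝 l)

/-- The jump of a path at a given time. -/
def jump (z : ℝ → E) (t : ℝ) : E := z t - limUnder (𝓝[<] t) z

lemma jump_eq_of_tendsto {z : ℝ → E} {t : ℝ} {l : E} (h : Tendsto z (𝓝[<] t) (𝓝 l)) :
    jump z t = z t - l := by
  rw [jump, h.limUnder_eq]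

lemma IsCadlag.tendsto_left {z : ℝ → E} (hz : IsCadlag z) {t : ℝ} (ht : 0 < t) :
    Tendsto z (𝓝[<] t) (𝓝 (z t - jump z t)) := by
  obtain ⟨l, hl⟩ := hz.2 t ht
  rw [jump_eq_of_tendsto hl]
  simpa using hl

lemma IsCadlag.tendsto_sub_left {z : ℝ → E} (hz : IsCadlag z) {t : ℝ} (ht : 0 < t) :
    Tendsto (fun u => z t - z u) (𝓝[<] t) (𝓝 (jump z t)) := by
  simpa using (tendsto_const_nhds (x := z t)).sub (hz.tendsto_left ht)

/-- Near a given time, increments of a càdlàg path are small up to the jump at this time. -/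
lemma IsCadlag.exists_nhds_increment {z : ℝ → E} (hz : IsCadlag z) {s : ℝ} (hs : 0 ≤ s) {η : ℝ}
    (hη : 0 < η) :
    ∃ U ∈ 𝓝 s, ∀ u ∈ U, ∀ v ∈ U, 0 ≤ u → u ≤ v →
      (u < s → s ≤ v → ‖z v - z u - jump z s‖ < η) ∧
      (¬ (u < s ∧ s ≤ v) → ‖z v - z u‖ < η) := by
  have hr : ∀ᶠ v in 𝓝[≥] s, ‖z v - z s‖ < η / 2 := by
    have := (hz.1 s hs).tendsto
    have := this.eventually (Metric.ball_mem_nhds (z s) (half_pos hη))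
    simpa [Metric.mem_ball, dist_eq_norm] using this
  have hl : ∀ᶠ u in 𝓝[<] s, 0 ≤ u → ‖z u - (z s - jump z s)‖ < η / 2 := by
    rcases hs.eq_or_lt with rfl | hs
    · filter_upwards [self_mem_nhdsWithin] with u hu hu'
      exact absurd hu (not_lt.2 hu')
    · have := (hz.tendsto_left hs).eventually (Metric.ball_mem_nhds _ (half_pos hη))
      filter_upwards [this] with u hu _
      simpa [Metric.mem_ball, dist_eq_norm] using hu
  rw [eventually_nhdsWithin_iff] at hr hl
  refine ⟨_, hr.and hl, ?_⟩
  rintro u ⟨hur, hul⟩ v ⟨hvr, hvl⟩ hu huv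
  refine ⟨fun hus hsv => ?_, fun h => ?_⟩
  · have h1 := hvr hsv
    have h2 := hul hus hu
    calc ‖z v - z u - jump z s‖ = ‖(z v - z s) - (z u - (z s - jump z s))‖ := by
          congr 1; abel
      _ ≤ _ := norm_sub_le _ _
      _ < η := by linarith
  · by_cases hus : u < s
    · have hvs : v < s := by
        by_contra hvs
        exact h ⟨hus, not_lt.1 hvs⟩
      have h1 := hvl hvs (hu.trans huv)
      have h2 := hul hus hu
      calc ‖z v - z u‖ = ‖(z v - (z s - jump z s)) - (z u - (z s - jump z s))‖ := by
            congr 1; abel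
        _ ≤ _ := norm_sub_le _ _
        _ < η := by linarith
    · have h1 := hvr ((not_lt.1 hus).trans huv)
      have h2 := hur (not_lt.1 hus)
      calc ‖z v - z u‖ = ‖(z v - z s) - (z u - z s)‖ := by congr 1; abel
        _ ≤ _ := norm_sub_le _ _
        _ < η := by linarith

lemma IsCadlag.finite_jumps {z : ℝ → E} (hz : IsCadlag z) {ε : ℝ} (hε : 0 < ε) (t : ℝ) :
    {s | s ∈ Set.Ioc 0 t ∧ ε ≤ ‖jump z s‖}.Finite := by
  have key : ∀ s ∈ Set.Icc 0 t, ∃ U ∈ 𝓝 s, ∀ r ∈ U, 0 < r → ε ≤ ‖jump z r‖ → r = s := by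
    intro s hs
    obtain ⟨U, hU, h⟩ := hz.exists_nhds_increment hs.1 (half_pos hε)
    refine ⟨interior U, interior_mem_nhds.2 hU, fun r hr hr0 hj => ?_⟩
    by_contra hne
    have hev : ∀ᶠ u in 𝓝[<] r, ‖z r - z u‖ ≤ ε / 2 := by
      have h1 : ∀ᶠ u in 𝓝[<] r, u ∈ U :=
        mem_nhdsWithin_of_mem_nhds (mem_interior_iff_mem_nhds.1 hr)
      have h2 : ∀ᶠ u in 𝓝[<] r, 0 < u := mem_nhdsWithin_of_mem_nhds (lt_mem_nhds hr0)
      have h3 : ∀ᶠ u in 𝓝[<] r, s < r → s < u := by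
        by_cases hsr : s < r
        · filter_upwards [mem_nhdsWithin_of_mem_nhds (lt_mem_nhds hsr)] with u hu _ using hu
        · simp [hsr]
      filter_upwards [h1, h2, h3, self_mem_nhdsWithin] with u hu hu0 hus hur
      refine ((h u hu r (interior_subset hr) hu0.le (le_of_lt hur)).2 ?_).le
      rintro ⟨hlt, hle⟩
      exact absurd (hus (lt_of_le_of_ne hle (Ne.symm hne))) (not_lt.2 hlt.le)
    have := le_of_tendsto (hz.tendsto_sub_left hr0).norm hev
    linarith
  choose! U hU h using key
  obtain ⟨F, hF, hcov⟩ := isCompact_Icc.elim_nhds_subcover U hU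
  refine F.finite_toSet.subset ?_
  rintro r ⟨⟨hr0, hrt⟩, hj⟩
  obtain ⟨s, hs, hrs⟩ := Set.mem_iUnion₂.1 (hcov ⟨hr0.le, hrt⟩)
  rw [h s (hF s hs) r hrs hr0 hj]
  exact hs

/-- Short increments without a jump of size `ε / 2` are smaller than `ε`. -/
lemma IsCadlag.exists_increment_lt {z : ℝ → E} (hz : IsCadlag z) {ε : ℝ} (hε : 0 < ε) (t : ℝ) :
    ∃ δ > 0, ∀ u v, 0 ≤ u → u ≤ v → v ≤ t → v - u < δ →
      (∀ s ∈ Set.Ioc u v, ‖jump z s‖ < ε / 2) → ‖z v - z u‖ < ε := by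
  have key : ∀ s ∈ Set.Icc 0 t, ∃ U ∈ 𝓝 s, ∀ u ∈ U, ∀ v ∈ U, 0 ≤ u → u ≤ v →
      (u < s → s ≤ v → ‖z v - z u - jump z s‖ < ε / 2) ∧
      (¬ (u < s ∧ s ≤ v) → ‖z v - z u‖ < ε / 2) :=
    fun s hs => hz.exists_nhds_increment hs.1 (half_pos hε)
  choose! U hU h using key
  obtain ⟨δ, hδ, hcov⟩ := lebesgue_number_lemma_of_metric (isCompact_Icc (a := (0 : ℝ)) (b := t))
    (c := fun s : Set.Icc 0 t => interior (U s)) (fun _ => isOpen_interior)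
    (fun s hs => Set.mem_iUnion.2 ⟨⟨s, hs⟩, mem_interior_iff_mem_nhds.2 (hU s hs)⟩)
  refine ⟨δ, hδ, fun u v hu huv hvt hlt hj => ?_⟩
  obtain ⟨s, hs⟩ := hcov u ⟨hu, huv.trans hvt⟩
  have h1 := h s s.2 u (interior_subset (hs (Metric.mem_ball_self hδ))) v
    (interior_subset <| hs (by
      rw [Metric.mem_ball, Real.dist_eq, abs_of_nonneg (by linarith)]
      exact hlt)) hu huv
  by_cases hc : u < s ∧ s ≤ v
  · have h2 := h1.1 hc.1 hc.2
    have h3 := hj s ⟨hc.1, hc.2⟩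
    calc ‖z v - z u‖ = ‖(z v - z u - jump z s) + jump z s‖ := by congr 1; abel
      _ ≤ _ := norm_add_le _ _
      _ < ε := by linarith
  · linarith [h1.2 hc]

/-- The sum of `f` over the jumps of a path in the time interval `(0, t]`. -/
def jumpSum {V : Type*} [AddCommMonoid V] (f : E → V) (t : ℝ) (z : ℝ → E) : V :=
  ∑ᶠ s ∈ Set.Ioc 0 t, f (jump z s)

lemma IsCadlag.finite_inter_support {V : Type*} [AddCommMonoid V] {z : ℝ → E} (hz : IsCadlag z)
    {f : E → V} {ε : ℝ} (hε : 0 < ε) (hf : ∀ x, ‖x‖ < ε → f x = 0) (t : ℝ) :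
    (Set.Ioc 0 t ∩ Function.support fun s => f (jump z s)).Finite := by
  refine (hz.finite_jumps hε t).subset fun s hs => ⟨hs.1, ?_⟩
  by_contra h
  exact hs.2 (hf _ (not_le.1 h))

lemma IsCadlag.jumpSum_eq_sum {V : Type*} [AddCommMonoid V] {z : ℝ → E} (hz : IsCadlag z)
    {f : E → V} {ε : ℝ} (hε : 0 < ε) (hf : ∀ x, ‖x‖ < ε → f x = 0) (t : ℝ) :
    jumpSum f t z = ∑ s ∈ (hz.finite_jumps hε t).toFinset, f (jump z s) := by
  refine finsum_mem_eq_sum_of_inter_support_eq _ ?_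
  ext s
  simp only [Set.mem_inter_iff, Function.mem_support, Set.Finite.coe_toFinset, Set.mem_ofPred_eq]
  refine ⟨fun h => ⟨⟨h.1, ?_⟩, h.2⟩, fun h => ⟨h.1.1, h.2⟩⟩
  by_contra h'
  exact h.2 (hf _ (not_le.1 h'))

lemma exists_separation {T : Set ℝ} (hT : T.Finite) :
    ∃ δ > 0, ∀ s ∈ T, ∀ r ∈ T, s ≠ r → δ ≤ |s - r| := by
  induction T, hT using Set.Finite.induction_on with
  | empty => exact ⟨1, one_pos, by simp⟩
  | @insert a S ha hS ih =>
    obtain ⟨δ, hδ, h⟩ := ih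
    obtain ⟨δ', hδ', h'⟩ := Metric.isOpen_iff.1 hS.isClosed.isOpen_compl a ha
    have h'' : ∀ r ∈ S, δ' ≤ |r - a| := fun r hr => by
      by_contra hc
      exact h' (by rw [Metric.mem_ball, Real.dist_eq]; exact not_le.1 hc) hr
    refine ⟨min δ δ', lt_min hδ hδ', ?_⟩
    rintro s (rfl | hs) r (rfl | hr) hsr
    · exact absurd rfl hsr
    · rw [abs_sub_comm]; exact (min_le_right _ _).trans (h'' r hr)
    · exact (min_le_right _ _).trans (h'' s hs)
    · exact (min_le_left _ _).trans (h s hs r hr hsr)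
lemma exists_grid_index {h s : ℝ} (hh : 0 < h) (hs : 0 < s) :
    ∃ k : ℕ, k * h < s ∧ s ≤ (k + 1) * h := by
  have h1 : 0 < ⌈s / h⌉₊ := Nat.ceil_pos.2 (by positivity)
  refine ⟨⌈s / h⌉₊ - 1, ?_, ?_⟩
  · rw [← lt_div_iff₀ hh]
    exact Nat.lt_ceil.1 (by omega)
  · rw [← div_le_iff₀ hh]
    have := Nat.le_ceil (s / h)
    rwa [Nat.cast_sub h1, Nat.cast_one, sub_add_cancel]

lemma grid_index_unique {h s : ℝ} (hh : 0 < h) {k l : ℕ} (hk : k * h < s) (hk' : s ≤ (k + 1) * h)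
    (hl : l * h < s) (hl' : s ≤ (l + 1) * h) : k = l := by
  have h1 : (k : ℝ) < l + 1 := lt_of_mul_lt_mul_right (hk.trans_le hl') hh.le
  have h2 : (l : ℝ) < k + 1 := lt_of_mul_lt_mul_right (hl.trans_le hk') hh.le
  norm_cast at h1 h2
  omega

lemma tendsto_mesh (t : ℝ) : Tendsto (fun m : ℕ => t / m) atTop (𝓝 0) :=
  tendsto_const_div_atTop_nhds_zero_nat t

/-- Sums of a continuous function over increments along finer and finer grids converge to the sum
over the jumps. -/
lemma IsCadlag.tendsto_grid_sum {V : Type*} [NormedAddCommGroup V] {z : ℝ → E} (hz : IsCadlag z)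
    {f : E → V} (hfc : Continuous f) {ε : ℝ} (hε : 0 < ε) (hf : ∀ x, ‖x‖ < ε → f x = 0)
    {t : ℝ} (ht : 0 < t) :
    Tendsto (fun m : ℕ => ∑ k ∈ Finset.range m, f (z ((k + 1) * (t / m)) - z (k * (t / m))))
      atTop (𝓝 (jumpSum f t z)) := by
  have hf' : ∀ x, ‖x‖ < ε / 2 → f x = 0 := fun x hx => hf x (by linarith)
  have hfin := hz.finite_jumps (half_pos hε) t
  rw [hz.jumpSum_eq_sum (half_pos hε) hf' t]
  obtain ⟨δ₁, hδ₁, hinc⟩ := hz.exists_increment_lt hε t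
  obtain ⟨δ₂, hδ₂, hsep⟩ := exists_separation hfin
  have hgrid : ∀ (m : ℕ) (s : ℝ), 0 < m → 0 < s →
      ∃ k : ℕ, k * (t / m) < s ∧ s ≤ (k + 1) * (t / m) :=
    fun m s hm hs => exists_grid_index (by positivity) hs
  choose! κ hκ hκ' using hgrid
  have hlim : Tendsto (fun m : ℕ => ∑ s ∈ hfin.toFinset,
      f (z ((κ m s + 1) * (t / m)) - z (κ m s * (t / m)))) atTop
      (𝓝 (∑ s ∈ hfin.toFinset, f (jump z s))) := by
    refine tendsto_finsetSum _ fun s hs => ?_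
    rw [Set.Finite.mem_toFinset] at hs
    have hs0 : 0 < s := hs.1.1
    have hr : Tendsto (fun m : ℕ => (κ m s + 1) * (t / m)) atTop (𝓝[≥] s) := by
      refine tendsto_nhdsWithin_iff.2 ⟨?_, ?_⟩
      · refine tendsto_of_tendsto_of_tendsto_of_le_of_le' tendsto_const_nhds
          (by simpa using (tendsto_mesh t).const_add s) ?_ ?_
        · filter_upwards [eventually_gt_atTop 0] with m hm using hκ' m s hm hs0
        · filter_upwards [eventually_gt_atTop 0] with m hm
          linarith [hκ m s hm hs0]
      · filter_upwards [eventually_gt_atTop 0] with m hm using hκ' m s hm hs0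
    have hl : Tendsto (fun m : ℕ => κ m s * (t / m)) atTop (𝓝[<] s) := by
      refine tendsto_nhdsWithin_iff.2 ⟨?_, ?_⟩
      · refine tendsto_of_tendsto_of_tendsto_of_le_of_le'
          (by simpa using (tendsto_mesh t).const_sub s) tendsto_const_nhds ?_ ?_
        · filter_upwards [eventually_gt_atTop 0] with m hm
          linarith [hκ' m s hm hs0]
        · filter_upwards [eventually_gt_atTop 0] with m hm using (hκ m s hm hs0).le
      · filter_upwards [eventually_gt_atTop 0] with m hm using hκ m s hm hs0
    have h1 := ((hz.1 s hs0.le).tendsto.comp hr).sub ((hz.tendsto_left hs0).comp hl)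
    rw [sub_sub_cancel] at h1
    exact (hfc.tendsto _).comp h1
  refine hlim.congr' ?_
  filter_upwards [eventually_gt_atTop 0, (tendsto_mesh t).eventually (gt_mem_nhds hδ₁),
    (tendsto_mesh t).eventually (gt_mem_nhds hδ₂)] with m hm hm₁ hm₂
  have hh : 0 < t / m := by positivity
  have hmt : (m : ℝ) * (t / m) = t := by field_simp
  have hinj : Set.InjOn (κ m) hfin.toFinset := by
    intro s hs r hr hsr
    rw [Set.Finite.coe_toFinset] at hs hr
    by_contra hne
    have h1 := hκ m s hm hs.1.1
    have h2 := hκ' m s hm hs.1.1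
    have h3 := hκ m r hm hr.1.1
    have h4 := hκ' m r hm hr.1.1
    rw [hsr] at h1 h2
    have h5 := hsep s hs r hr hne
    have : |s - r| < δ₂ := by rw [abs_lt]; constructor <;> linarith
    linarith
  rw [← Finset.sum_image (f := fun k : ℕ => f (z ((k + 1) * (t / m)) - z (k * (t / m)))) hinj]
  refine Finset.sum_subset ?_ fun k hk hk' => hf _ ?_
  · intro k hk
    obtain ⟨s, hs, rfl⟩ := Finset.mem_image.1 hk
    rw [Set.Finite.mem_toFinset] at hs
    rw [Finset.mem_range]
    have h1 : (κ m s : ℝ) * (t / m) < m * (t / m) := by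
      rw [hmt]
      exact (hκ m s hm hs.1.1).trans_le hs.1.2
    exact_mod_cast lt_of_mul_lt_mul_right h1 hh.le
  · have hkm : ((k : ℝ) + 1) ≤ m := by exact_mod_cast Finset.mem_range.1 hk
    have hkt : ((k : ℝ) + 1) * (t / m) ≤ t :=
      (mul_le_mul_of_nonneg_right hkm hh.le).trans_eq hmt
    refine hinc _ _ (by positivity) (by nlinarith) hkt (by linarith) fun s hs => ?_
    by_contra hj
    have hs0 : 0 < s := lt_of_le_of_lt (by positivity) hs.1
    refine hk' (Finset.mem_image.2 ⟨s, ?_, ?_⟩)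
    · rw [Set.Finite.mem_toFinset]
      exact ⟨⟨hs0, hs.2.trans hkt⟩, not_lt.1 hj⟩
    · exact grid_index_unique hh (hκ m s hm hs0) (hκ' m s hm hs0) hs.1 hs.2

lemma IsCadlag.tendsto_jumpSum {V : Type*} [NormedAddCommGroup V] {z : ℝ → E} (hz : IsCadlag z)
    {f : ℕ → E → V} {g : E → V} {ε : ℝ} (hε : 0 < ε) (hf : ∀ j x, ‖x‖ < ε → f j x = 0)
    (h : ∀ x, Tendsto (f · x) atTop (𝓝 (g x))) (t : ℝ) :
    Tendsto (fun j => jumpSum (f j) t z) atTop (𝓝 (jumpSum g t z)) := by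
  have hg : ∀ x, ‖x‖ < ε → g x = 0 := fun x hx =>
    tendsto_nhds_unique (h x) (by simp [hf _ x hx])
  simp_rw [fun j => hz.jumpSum_eq_sum hε (hf j) t, hz.jumpSum_eq_sum hε hg t]
  exact tendsto_finsetSum _ fun s _ => h _

lemma IsCadlag.jumpSum_add {V : Type*} [AddCommMonoid V] {z : ℝ → E} (hz : IsCadlag z)
    {f g : E → V} {ε : ℝ} (hε : 0 < ε) (hf : ∀ x, ‖x‖ < ε → f x = 0)
    (hg : ∀ x, ‖x‖ < ε → g x = 0) (t : ℝ) :
    jumpSum (fun x => f x + g x) t z = jumpSum f t z + jumpSum g t z :=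
  finsum_mem_add_distrib' (hz.finite_inter_support hε hf t) (hz.finite_inter_support hε hg t)

lemma jumpSum_of_nonpos {V : Type*} [AddCommMonoid V] (f : E → V) {t : ℝ} (ht : t ≤ 0)
    (z : ℝ → E) : jumpSum f t z = 0 := by
  simp [jumpSum, Set.Ioc_eq_empty (not_lt.2 ht)]

section Measurability

variable [MeasurableSpace E] [BorelSpace E] [SecondCountableTopology E]
  {Ω : Type*} [MeasurableSpace Ω] {X : Ω → ℝ → E}

lemma measurable_jumpSum_of_continuous (hX : ∀ ω, IsCadlag (X ω))
    (hm : ∀ r, 0 ≤ r → Measurable fun ω => X ω r) {f : E → ℝ} (hfc : Continuous f) {ε : ℝ}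
    (hε : 0 < ε) (hf : ∀ x, ‖x‖ < ε → f x = 0) {t : ℝ} (ht : 0 < t) :
    Measurable fun ω => jumpSum f t (X ω) := by
  refine measurable_of_tendsto_metrizable (f := fun (m : ℕ) ω =>
    ∑ k ∈ Finset.range m, f (X ω ((k + 1) * (t / m)) - X ω (k * (t / m)))) (fun m => ?_)
    (tendsto_pi_nhds.2 fun ω => (hX ω).tendsto_grid_sum hfc hε hf ht)
  refine Finset.measurable_fun_sum _ fun k _ => hfc.measurable.comp ?_
  exact (hm _ (by positivity)).sub (hm _ (by positivity))

lemma measurable_jumpSum_indicator_one (hX : ∀ ω, IsCadlag (X ω))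
    (hm : ∀ r, 0 ≤ r → Measurable fun ω => X ω r) {ε : ℝ} (hε : 0 < ε) {t : ℝ} (ht : 0 < t)
    {B : Set E} (hB : MeasurableSet B) :
    Measurable fun ω =>
      jumpSum ((B ∩ {x : E | ε ≤ ‖x‖}).indicator (fun _ => (1 : ℝ))) t (X ω) := by
  set K : Set E := {x : E | ε ≤ ‖x‖} with hK
  have hKc : IsClosed K := isClosed_le continuous_const continuous_norm
  have hvan : ∀ (A : Set E) (x : E), ‖x‖ < ε → (A ∩ K).indicator (fun _ => (1 : ℝ)) x = 0 :=
    fun A x hx => Set.indicator_of_notMem (fun h => absurd h.2 (not_le.2 hx)) _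
  have hclosed : ∀ F : Set E, IsClosed F →
      Measurable fun ω => jumpSum ((F ∩ K).indicator (fun _ => (1 : ℝ))) t (X ω) := by
    intro F hF
    obtain ⟨δ, -, hδ, hδ0⟩ := exists_seq_strictAnti_tendsto' (half_pos hε)
    have hδpos : ∀ j, 0 < δ j := fun j => (hδ j).1
    have hvan' : ∀ j (x : E), ‖x‖ < ε / 2 →
        (thickenedIndicator (hδpos j) (F ∩ K) x : ℝ) = 0 := by
      intro j x hx
      rw [thickenedIndicator_zero (hδpos j)]
      · rfl
      · rw [Metric.mem_thickening_iff]
        rintro ⟨y, ⟨-, hy⟩, hxy⟩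
        rw [dist_eq_norm] at hxy
        have h1 : ‖y‖ ≤ ‖x‖ + ‖x - y‖ := by
          calc ‖y‖ = ‖x - (x - y)‖ := by congr 1; abel
            _ ≤ _ := norm_sub_le _ _
        have h2 : ε ≤ ‖y‖ := hy
        linarith [(hδ j).2]
    refine measurable_of_tendsto_metrizable (f := fun (j : ℕ) ω =>
      jumpSum (fun x => (thickenedIndicator (hδpos j) (F ∩ K) x : ℝ)) t (X ω)) (fun j => ?_)
      (tendsto_pi_nhds.2 fun ω => (hX ω).tendsto_jumpSum (half_pos hε) hvan' (fun x => ?_) t)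
    · exact measurable_jumpSum_of_continuous hX hm
        (NNReal.continuous_coe.comp (thickenedIndicator (hδpos j) (F ∩ K)).continuous)
        (half_pos hε) (hvan' j) ht
    · have := tendsto_pi_nhds.1
        (thickenedIndicator_tendsto_indicator_closure hδpos hδ0 (F ∩ K)) x
      rw [(hF.inter hKc).closure_eq] at this
      have := (NNReal.continuous_coe.tendsto _).comp this
      have hcoe : (F ∩ K).indicator (fun _ => (1 : ℝ)) x =
          ((F ∩ K).indicator (fun _ => (1 : NNReal)) x : NNReal) := by
        by_cases hx : x ∈ F ∩ K
        · rw [Set.indicator_of_mem hx, Set.indicator_of_mem hx, NNReal.coe_one]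
        · rw [Set.indicator_of_notMem hx, Set.indicator_of_notMem hx, NNReal.coe_zero]
      rw [hcoe]
      exact this
  have hgen : ‹MeasurableSpace E› = MeasurableSpace.generateFrom {s | IsClosed s} := by
    rw [BorelSpace.measurable_eq (α := E), borel_eq_generateFrom_isClosed]
  induction B, hB using MeasurableSpace.induction_on_inter hgen isPiSystem_isClosed with
  | empty => simp [jumpSum]
  | basic F hF => exact hclosed F hF
  | compl A hA ih =>
    have : ∀ ω, jumpSum ((Aᶜ ∩ K).indicator (fun _ => (1 : ℝ))) t (X ω) =
        jumpSum ((Set.univ ∩ K).indicator (fun _ => (1 : ℝ))) t (X ω) -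
          jumpSum ((A ∩ K).indicator (fun _ => (1 : ℝ))) t (X ω) := by
      intro ω
      rw [eq_sub_iff_add_eq, ← (hX ω).jumpSum_add hε (hvan _) (hvan _)]
      congr 1
      ext x
      by_cases hx : x ∈ A <;> by_cases hxK : x ∈ K <;> simp [hx, hxK]
    simp_rw [this]
    exact (hclosed _ isClosed_univ).sub ih
  | iUnion A hd hA ih =>
    have hsum : ∀ ω N, jumpSum (fun x => ∑ i ∈ Finset.range N,
        (A i ∩ K).indicator (fun _ => (1 : ℝ)) x) t (X ω) =
        ∑ i ∈ Finset.range N, jumpSum ((A i ∩ K).indicator (fun _ => (1 : ℝ))) t (X ω) := by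
      intro ω N
      induction N with
      | zero => simp [jumpSum]
      | succ N ihN =>
        simp_rw [Finset.sum_range_succ, ← ihN]
        exact (hX ω).jumpSum_add hε
          (fun x hx => Finset.sum_eq_zero fun i _ => hvan _ x hx) (hvan _) t
    refine measurable_of_tendsto_metrizable (f := fun (N : ℕ) ω =>
      ∑ i ∈ Finset.range N, jumpSum ((A i ∩ K).indicator (fun _ => (1 : ℝ))) t (X ω))
      (fun N => Finset.measurable_fun_sum _ fun i _ => ih i) (tendsto_pi_nhds.2 fun ω => ?_)
    simp_rw [← hsum ω]
    refine (hX ω).tendsto_jumpSum hε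
      (fun N x hx => Finset.sum_eq_zero fun i _ => hvan _ x hx) (fun x => ?_) t
    by_cases hx : x ∈ (⋃ i, A i) ∩ K
    · obtain ⟨hxA, hxK⟩ := hx
      obtain ⟨i, hi⟩ := Set.mem_iUnion.1 hxA
      refine tendsto_const_nhds.congr' ?_
      filter_upwards [eventually_gt_atTop i] with N hN
      rw [Finset.sum_eq_single_of_mem i (Finset.mem_range.2 hN)]
      · rw [Set.indicator_of_mem (show x ∈ _ ∩ K from ⟨hxA, hxK⟩),
          Set.indicator_of_mem (show x ∈ _ ∩ K from ⟨hi, hxK⟩)]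
      · intro j _ hj
        exact Set.indicator_of_notMem
          (fun h => Set.disjoint_left.1 (hd hj) h.1 hi) _
    · rw [Set.indicator_of_notMem hx]
      refine tendsto_const_nhds.congr fun N => (Finset.sum_eq_zero fun i _ => ?_).symm
      exact Set.indicator_of_notMem (fun h => hx ⟨Set.mem_iUnion.2 ⟨i, h.1⟩, h.2⟩) _

lemma measurable_jumpSum {V : Type*} [NormedAddCommGroup V] [NormedSpace ℝ V]
    [MeasurableSpace V] [BorelSpace V] [SecondCountableTopology V]
    (hX : ∀ ω, IsCadlag (X ω)) (hm : ∀ r, 0 ≤ r → Measurable fun ω => X ω r) {f : E → V}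
    (hfm : Measurable f) {ε : ℝ} (hε : 0 < ε) (hf : ∀ x, ‖x‖ < ε → f x = 0) (t : ℝ) :
    Measurable fun ω => jumpSum f t (X ω) := by
  rcases le_or_gt t 0 with ht | ht
  · simp_rw [jumpSum_of_nonpos f ht]
    exact measurable_const
  set K : Set E := {x : E | ε ≤ ‖x‖} with hK
  have hvan : ∀ (g : E → V) (x : E), ‖x‖ < ε → K.indicator g x = 0 :=
    fun g x hx => Set.indicator_of_notMem (fun h : x ∈ K => absurd hx (not_lt.2 h)) _
  suffices H : ∀ g : E → V, StronglyMeasurable g →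
      Measurable fun ω => jumpSum (K.indicator g) t (X ω) by
    convert H f hfm.stronglyMeasurable using 3
    ext x
    by_cases hx : x ∈ K
    · rw [Set.indicator_of_mem hx]
    · rw [Set.indicator_of_notMem hx, hf x (not_le.1 hx)]
  intro g hg
  induction g, hg using StronglyMeasurable.induction with
  | ind c hs =>
    rename_i s
    have hvan' : ∀ x : E, ‖x‖ < ε → (s ∩ K).indicator (fun _ => (1 : ℝ)) x = 0 :=
      fun x hx => Set.indicator_of_notMem (fun h => absurd h.2 (not_le.2 hx)) _
    have : ∀ ω, jumpSum (K.indicator (s.indicator fun _ => c)) t (X ω) =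
        jumpSum ((s ∩ K).indicator (fun _ => (1 : ℝ))) t (X ω) • c := by
      intro ω
      rw [(hX ω).jumpSum_eq_sum hε (hvan _), (hX ω).jumpSum_eq_sum hε hvan', Finset.sum_smul]
      refine Finset.sum_congr rfl fun r _ => ?_
      by_cases h1 : jump (X ω) r ∈ K <;> by_cases h2 : jump (X ω) r ∈ s <;> simp [h1, h2]
    simp_rw [this]
    exact (measurable_jumpSum_indicator_one hX hm hε ht hs).smul_const c
  | add hf hg hfg hd h1 h2 =>
    rename_i g₁ g₂
    have : ∀ ω, jumpSum (K.indicator (g₁ + g₂)) t (X ω) =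
        jumpSum (K.indicator g₁) t (X ω) + jumpSum (K.indicator g₂) t (X ω) := by
      intro ω
      rw [← (hX ω).jumpSum_add hε (hvan _) (hvan _), Set.indicator_add']
      rfl
    simp_rw [this]
    exact h1.add h2
  | lim hf hg h1 h2 =>
    refine measurable_of_tendsto_metrizable h1 (tendsto_pi_nhds.2 fun ω =>
      (hX ω).tendsto_jumpSum hε (fun j => hvan _) (fun x => ?_) t)
    by_cases hx : x ∈ K
    · simpa [hx] using h2 x
    · simp [hx]

end Measurability

/-- The increments of a path after time `t`. -/
def shiftPath (t : ℝ) (z : ℝ → E) (r : ℝ) : E := z (t + max r 0) - z t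

/-- The path stopped at time `t`. -/
def stopPath {α : Type*} (t : ℝ) (z : ℝ → α) (r : ℝ) : α := z (max 0 (min r t))

lemma tendsto_shiftPath_left {z : ℝ → E} {t s : ℝ} (hs : 0 < s) {l : E}
    (h : Tendsto z (𝓝[<] (t + s)) (𝓝 l)) :
    Tendsto (shiftPath t z) (𝓝[<] s) (𝓝 (l - z t)) := by
  have h1 : Tendsto (fun r => t + max r 0) (𝓝[<] s) (𝓝[<] (t + s)) := by
    refine tendsto_nhdsWithin_iff.2 ⟨?_, ?_⟩
    · have : Continuous fun r : ℝ => t + max r 0 := by fun_prop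
      have := (this.tendsto s).mono_left (nhdsWithin_le_nhds (s := Set.Iio s))
      rwa [max_eq_left hs.le] at this
    · filter_upwards [self_mem_nhdsWithin] with r hr
      exact (add_lt_add_iff_left t).2 (max_lt hr hs)
  exact (h.comp h1).sub_const _

lemma IsCadlag.shiftPath {z : ℝ → E} (hz : IsCadlag z) {t : ℝ} (ht : 0 ≤ t) :
    IsCadlag (shiftPath t z) := by
  refine ⟨fun s hs => ?_, fun s hs => ?_⟩
  · have h1 : Tendsto (fun r => t + max r 0) (𝓝[≥] s) (𝓝[≥] (t + s)) := by
      refine tendsto_nhdsWithin_iff.2 ⟨?_, ?_⟩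
      · have : Continuous fun r : ℝ => t + max r 0 := by fun_prop
        have := (this.tendsto s).mono_left (nhdsWithin_le_nhds (s := Set.Ici s))
        rwa [max_eq_left hs] at this
      · filter_upwards [self_mem_nhdsWithin] with r hr
        exact (add_le_add_iff_left t).2 (le_max_of_le_left hr)
    have h2 := ((hz.1 (t + s) (by positivity)).tendsto.comp h1).sub_const (z t)
    have h3 : _root_.shiftPath t z s = z (t + s) - z t := by rw [_root_.shiftPath, max_eq_left hs]
    rw [ContinuousWithinAt, h3]
    exact h2
  · obtain ⟨l, hl⟩ := hz.2 (t + s) (by positivity)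
    exact ⟨_, tendsto_shiftPath_left hs hl⟩

lemma IsCadlag.jump_shiftPath {z : ℝ → E} (hz : IsCadlag z) {t s : ℝ} (ht : 0 ≤ t) (hs : 0 < s) :
    jump (_root_.shiftPath t z) s = jump z (t + s) := by
  rw [jump_eq_of_tendsto (tendsto_shiftPath_left hs (hz.tendsto_left (by positivity))),
    _root_.shiftPath, max_eq_left hs.le]
  abel

lemma stopPath_of_mem {α : Type*} {t r : ℝ} (z : ℝ → α) (hr : 0 ≤ r) (hrt : r ≤ t) :
    stopPath t z r = z r := by
  rw [stopPath, min_eq_left hrt, max_eq_right hr]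

lemma tendsto_stopPath_left {z : ℝ → E} {t s : ℝ} (hs : 0 < s) (hst : s ≤ t) {l : E}
    (h : Tendsto z (𝓝[<] s) (𝓝 l)) : Tendsto (stopPath t z) (𝓝[<] s) (𝓝 l) := by
  refine h.congr' ?_
  filter_upwards [self_mem_nhdsWithin, mem_nhdsWithin_of_mem_nhds (lt_mem_nhds hs)] with r hr hr0
  exact (stopPath_of_mem z hr0.le ((le_of_lt hr).trans hst)).symm

lemma IsCadlag.stopPath {z : ℝ → E} (hz : IsCadlag z) (t : ℝ) : IsCadlag (stopPath t z) := by
  have hcont : Continuous fun r : ℝ => max 0 (min r t) := by fun_prop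
  refine ⟨fun s hs => ?_, fun s hs => ?_⟩
  · have h1 : Tendsto (fun r => max 0 (min r t)) (𝓝[≥] s) (𝓝[≥] (max 0 (min s t))) := by
      refine tendsto_nhdsWithin_iff.2
        ⟨(hcont.tendsto s).mono_left (nhdsWithin_le_nhds (s := Set.Ici s)), ?_⟩
      filter_upwards [self_mem_nhdsWithin] with r hr
      exact max_le_max_left _ (min_le_min_right _ (show s ≤ r from hr))
    exact (hz.1 _ (le_max_left _ _)).tendsto.comp h1
  · rcases le_or_gt s t with hst | hst
    · obtain ⟨l, hl⟩ := hz.2 s hs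
      exact ⟨l, tendsto_stopPath_left hs hst hl⟩
    · refine ⟨z (max 0 t), tendsto_const_nhds.congr' ?_⟩
      filter_upwards [mem_nhdsWithin_of_mem_nhds (lt_mem_nhds hst)] with r hr
      rw [_root_.stopPath, min_eq_right (le_of_lt hr)]

lemma IsCadlag.jump_stopPath {z : ℝ → E} (hz : IsCadlag z) {t s : ℝ} (hs : 0 < s) (hst : s ≤ t) :
    jump (_root_.stopPath t z) s = jump z s := by
  rw [jump_eq_of_tendsto (tendsto_stopPath_left hs hst (hz.tendsto_left hs)),
    stopPath_of_mem z hs.le hst]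
  abel

section JumpSum

variable {V : Type*} [AddCommMonoid V]

lemma IsCadlag.jumpSum_stopPath {z : ℝ → E} (hz : IsCadlag z) {r t : ℝ} (hrt : r ≤ t) (f : E → V) :
    jumpSum f r (_root_.stopPath t z) = jumpSum f r z :=
  finsum_mem_congr rfl fun s hs => by rw [hz.jump_stopPath hs.1 (hs.2.trans hrt)]

lemma IsCadlag.jumpSum_shiftPath_zero {z : ℝ → E} (hz : IsCadlag z) (t : ℝ) (f : E → V) :
    jumpSum f t (_root_.shiftPath 0 z) = jumpSum f t z :=
  finsum_mem_congr rfl fun s hs => by rw [hz.jump_shiftPath le_rfl hs.1, zero_add]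

lemma IsCadlag.jumpSum_add_time {z : ℝ → E} (hz : IsCadlag z) {f : E → V} {ε : ℝ} (hε : 0 < ε)
    (hf : ∀ x, ‖x‖ < ε → f x = 0) {s t : ℝ} (hs : 0 ≤ s) (ht : 0 ≤ t) :
    jumpSum f (t + s) z = jumpSum f t z + jumpSum f s (_root_.shiftPath t z) := by
  have h1 : jumpSum f s (_root_.shiftPath t z) = ∑ᶠ r ∈ Set.Ioc t (t + s), f (jump z r) := by
    have himg : Set.Ioc t (t + s) = (fun r => t + r) '' Set.Ioc 0 s := by
      simp [add_comm]
    rw [himg, finsum_mem_image ((add_right_injective t).injOn)]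
    exact finsum_mem_congr rfl fun r hr => by rw [hz.jump_shiftPath ht hr.1]
  have hfin := hz.finite_inter_support hε hf (t + s)
  rw [h1, jumpSum, jumpSum, ← Set.Ioc_union_Ioc_eq_Ioc ht (by linarith : t ≤ t + s)]
  rw [← Set.Ioc_union_Ioc_eq_Ioc ht (by linarith : t ≤ t + s)] at hfin
  refine finsum_mem_union' (Set.disjoint_left.2 fun x hx hx' => ?_)
    (hfin.subset (Set.inter_subset_inter_left _ Set.subset_union_left))
    (hfin.subset (Set.inter_subset_inter_left _ Set.subset_union_right))
  exact absurd hx.2 (not_le.2 hx'.1)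

end JumpSum

end Path

section Independence

open MeasurableSpace

lemma isPiSystem_inter_and_sup_eq_generateFrom {Ω : Type*} (m₁ m₂ : MeasurableSpace Ω) :
    IsPiSystem {s | ∃ a b, MeasurableSet[m₁] a ∧ MeasurableSet[m₂] b ∧ s = a ∩ b} ∧
      m₁ ⊔ m₂ =
        generateFrom {s | ∃ a b, MeasurableSet[m₁] a ∧ MeasurableSet[m₂] b ∧ s = a ∩ b} := by
  refine ⟨?_, le_antisymm (sup_le (fun s hs => ?_) fun s hs => ?_) (generateFrom_le ?_)⟩
  · rintro _ ⟨a, b, ha, hb, rfl⟩ _ ⟨c, d, hc, hd, rfl⟩ -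
    exact ⟨a ∩ c, b ∩ d, ha.inter hc, hb.inter hd, Set.inter_inter_inter_comm _ _ _ _⟩
  · exact measurableSet_generateFrom ⟨s, Set.univ, hs, MeasurableSet.univ, by simp⟩
  · exact measurableSet_generateFrom ⟨Set.univ, s, MeasurableSet.univ, hs, by simp⟩
  · rintro _ ⟨a, b, ha, hb, rfl⟩
    exact (le_sup_left (a := m₁) (b := m₂) a ha).inter (le_sup_right (a := m₁) (b := m₂) b hb)

variable {Ω : Type*} {mΩ : MeasurableSpace Ω} {P : Measure Ω}

lemma indep_sup_sup [IsProbabilityMeasure P] {A₁ A₂ W₁ W₂ : MeasurableSpace Ω} (hA₁ : A₁ ≤ mΩ)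
    (hA₂ : A₂ ≤ mΩ) (hW₁ : W₁ ≤ mΩ) (hW₂ : W₂ ≤ mΩ) (hA : Indep A₁ A₂ P) (hW : Indep W₁ W₂ P)
    (hAW : Indep (A₁ ⊔ A₂) (W₁ ⊔ W₂) P) : Indep (A₁ ⊔ W₁) (A₂ ⊔ W₂) P := by
  obtain ⟨hp₁, hg₁⟩ := isPiSystem_inter_and_sup_eq_generateFrom A₁ W₁
  obtain ⟨hp₂, hg₂⟩ := isPiSystem_inter_and_sup_eq_generateFrom A₂ W₂
  refine IndepSets.indep (sup_le hA₁ hW₁) (sup_le hA₂ hW₂) hp₁ hp₂ hg₁ hg₂ ?_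
  rw [IndepSets_iff]
  rintro _ _ ⟨a₁, w₁, ha₁, hw₁, rfl⟩ ⟨a₂, w₂, ha₂, hw₂, rfl⟩
  rw [Indep_iff] at hA hW hAW
  have ha₁' := le_sup_left (a := A₁) (b := A₂) a₁ ha₁
  have ha₂' := le_sup_right (a := A₁) (b := A₂) a₂ ha₂
  have hw₁' := le_sup_left (a := W₁) (b := W₂) w₁ hw₁
  have hw₂' := le_sup_right (a := W₁) (b := W₂) w₂ hw₂
  rw [Set.inter_inter_inter_comm, hAW _ _ (ha₁'.inter ha₂') (hw₁'.inter hw₂'), hA _ _ ha₁ ha₂,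
    hW _ _ hw₁ hw₂, hAW _ _ ha₁' hw₁', hAW _ _ ha₂' hw₂']
  ring

/-- Two families of σ-algebras, each driven by increments that are jointly independent of the past
and independent of each other, are independent. -/
lemma indep_iSup_of_increments [IsProbabilityMeasure P] {A₁ A₂ : NNReal → MeasurableSpace Ω}
    {W₁ W₂ : NNReal → NNReal → MeasurableSpace Ω} (hA₁ : ∀ t, A₁ t ≤ mΩ) (hA₂ : ∀ t, A₂ t ≤ mΩ)
    (hW₁ : ∀ s t, W₁ s t ≤ mΩ) (hW₂ : ∀ s t, W₂ s t ≤ mΩ)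
    (h₁ : ∀ s t, s ≤ t → A₁ t ≤ A₁ s ⊔ W₁ s t) (h₂ : ∀ s t, s ≤ t → A₂ t ≤ A₂ s ⊔ W₂ s t)
    (h0 : Indep (A₁ 0) (A₂ 0) P) (hW : ∀ s t, s ≤ t → Indep (W₁ s t) (W₂ s t) P)
    (hAW : ∀ s t, s ≤ t → Indep (⨆ r ≤ s, A₁ r ⊔ A₂ r) (W₁ s t ⊔ W₂ s t) P) :
    Indep (⨆ t, A₁ t) (⨆ t, A₂ t) P := by
  have hfin : ∀ I : Finset NNReal,
      Indep (⨆ t ∈ insert 0 I, A₁ t) (⨆ t ∈ insert 0 I, A₂ t) P := by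
    intro I
    induction I using Finset.induction_on_max with
    | empty => simpa using h0
    | insert a I ha ih =>
      set J := insert 0 I with hJ
      have hJne : J.Nonempty := Finset.insert_nonempty _ _
      set b := J.max' hJne with hb
      have hbJ : b ∈ J := J.max'_mem hJne
      have hba : b ≤ a := by
        rcases Finset.mem_insert.1 hbJ with h | h
        · rw [h]; exact zero_le
        · exact (ha b h).le
      have hle : ∀ (A : NNReal → MeasurableSpace Ω) (W : NNReal → NNReal → MeasurableSpace Ω),
          A a ≤ A b ⊔ W b a → (⨆ t ∈ insert 0 (insert a I), A t) ≤ (⨆ t ∈ J, A t) ⊔ W b a := by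
        intro A W h
        rw [Finset.insert_comm, Finset.iSup_insert]
        exact sup_le (h.trans (sup_le_sup_right (le_iSup₂ (f := fun t (_ : t ∈ J) => A t) b hbJ) _))
          le_sup_left
      refine indep_of_indep_of_le (indep_sup_sup (iSup₂_le fun t _ => hA₁ t)
        (iSup₂_le fun t _ => hA₂ t) (hW₁ b a) (hW₂ b a) ih (hW b a hba)
        (indep_of_indep_of_le_left (hAW b a hba) ?_)) (hle A₁ W₁ (h₁ b a hba))
        (hle A₂ W₂ (h₂ b a hba))
      exact sup_le
        (iSup₂_le fun t ht => le_iSup₂_of_le t (J.le_max' t ht) le_sup_left)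
        (iSup₂_le fun t ht => le_iSup₂_of_le t (J.le_max' t ht) le_sup_right)
  have hmono : ∀ A : NNReal → MeasurableSpace Ω,
      Monotone fun I : Finset NNReal => ⨆ t ∈ I, A t :=
    fun A I J hIJ => biSup_mono fun t ht => hIJ ht
  rw [iSup_eq_iSup_finset A₁, iSup_eq_iSup_finset A₂]
  have hle : ∀ A : NNReal → MeasurableSpace Ω, (∀ t, A t ≤ mΩ) →
      ∀ I : Finset NNReal, ⨆ t ∈ I, A t ≤ mΩ := fun A h I => iSup₂_le fun t _ => h t
  refine indep_iSup_of_monotone (fun I => ?_) (hle A₁ hA₁) (iSup_le (hle A₂ hA₂)) (hmono A₁)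
  refine (indep_iSup_of_monotone (fun J => ?_) (hle A₂ hA₂) (hle A₁ hA₁ I) (hmono A₂)).symm
  refine indep_of_indep_of_le (hfin (I ∪ J)).symm (hmono A₂ ?_) (hmono A₁ ?_)
  · exact Finset.subset_union_right.trans (Finset.subset_insert _ _)
  · exact Finset.subset_union_left.trans (Finset.subset_insert _ _)

variable {E : Type*} [AddCommGroup E] [MeasurableSpace E] [MeasurableAdd₂ E] [MeasurableSub₂ E]

/-- Two processes started at `0`, whose increments are independent of the past and have the same
law, have the same law. -/
lemma map_eq_of_increments [IsProbabilityMeasure P] {Y Z : NNReal → Ω → E}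
    (hY : ∀ t, Measurable (Y t)) (hZ : ∀ t, Measurable (Z t)) (hY0 : ∀ ω, Y 0 ω = 0)
    (hZ0 : ∀ ω, Z 0 ω = 0)
    (hYZ : ∀ s t, s ≤ t → P.map (fun ω => Y t ω - Y s ω) = P.map (fun ω => Z t ω - Z s ω))
    (hYi : ∀ s t, s ≤ t →
      IndepFun (fun ω => Y t ω - Y s ω) (fun ω (r : Set.Iic s) => Y r ω) P)
    (hZi : ∀ s t, s ≤ t →
      IndepFun (fun ω => Z t ω - Z s ω) (fun ω (r : Set.Iic s) => Z r ω) P) :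
    P.map (fun ω t => Y t ω) = P.map (fun ω t => Z t ω) := by
  classical
  let trunc : Finset NNReal → (NNReal → Ω → E) → Ω → NNReal → E :=
    fun I Y ω r => if r ∈ insert 0 I then Y r ω else 0
  have htrunc : ∀ I (Y : NNReal → Ω → E), (∀ t, Measurable (Y t)) → Measurable (trunc I Y) := by
    intro I Y hY
    refine measurable_pi_lambda _ fun r => ?_
    by_cases hr : r ∈ insert 0 I
    · simp only [trunc, hr, if_true]
      exact hY r
    · simp only [trunc, hr, if_false]
      exact measurable_const
  have hmap : ∀ I : Finset NNReal, P.map (trunc I Y) = P.map (trunc I Z) := by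
    intro I
    induction I using Finset.induction_on_max with
    | empty =>
      congr 1
      ext ω r
      by_cases hr : r = 0 <;> simp [trunc, hr, hY0, hZ0]
    | insert a I ha ih =>
      set J := insert 0 I with hJ
      have hJne : J.Nonempty := Finset.insert_nonempty _ _
      set b := J.max' hJne with hb
      have hbJ : b ∈ J := J.max'_mem hJne
      have hba : b ≤ a := by
        rcases Finset.mem_insert.1 hbJ with h | h
        · rw [h]; exact zero_le
        · exact (ha b h).le
      let g : (NNReal → E) × E → NNReal → E := fun p r => if r = a then p.1 b + p.2 else p.1 r
      have hg : Measurable g := by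
        refine measurable_pi_lambda _ fun r => ?_
        by_cases hr : r = a
        · simp only [g, hr, if_true]
          fun_prop
        · simp only [g, hr, if_false]
          fun_prop
      have key : ∀ Y : NNReal → Ω → E, (∀ t, Measurable (Y t)) →
          IndepFun (fun ω => Y a ω - Y b ω) (fun ω (r : Set.Iic b) => Y r ω) P →
          P.map (trunc (insert a I) Y) =
            ((P.map (trunc I Y)).prod (P.map fun ω => Y a ω - Y b ω)).map g := by
        intro Y hY hi
        let φ : (Set.Iic b → E) → NNReal → E :=
          fun p r => if h : r ∈ J then p ⟨r, J.le_max' r h⟩ else 0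
        have hφ : Measurable φ := by
          refine measurable_pi_lambda _ fun r => ?_
          by_cases hr : r ∈ J
          · simp only [φ, hr, dite_true]
            exact measurable_pi_apply _
          · simp [φ, hr]
        have hi' : IndepFun (trunc I Y) (fun ω => Y a ω - Y b ω) P := by
          have heq : trunc I Y = φ ∘ fun ω (r : Set.Iic b) => Y r ω := by
            ext ω r
            by_cases hr : r ∈ J
            · simp only [trunc, φ, ← hJ, hr, Function.comp, if_true, dite_true]
            · simp only [trunc, φ, ← hJ, hr, Function.comp, if_false, dite_false]
          rw [heq]
          exact (hi.comp measurable_id hφ).symm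
        have hW : Measurable fun ω => Y a ω - Y b ω := (hY a).sub (hY b)
        rw [← (indepFun_iff_map_prod_eq_prod_map_map (htrunc I Y hY).aemeasurable
          hW.aemeasurable).1 hi', Measure.map_map hg ((htrunc I Y hY).prodMk hW)]
        congr 1
        ext ω r
        by_cases hr : r = a
        · simp only [trunc, g, Function.comp, hr, if_true, ← hJ, hbJ]
          simp
        · simp [trunc, g, hr]
      rw [key Y hY (hYi b a hba), key Z hZ (hZi b a hba), ih, hYZ b a hba]
  rw [map_eq_iff_forall_finset_map_restrict_eq (measurable_pi_lambda _ hY).aemeasurable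
    (measurable_pi_lambda _ hZ).aemeasurable]
  intro I
  have hres : ∀ Y : NNReal → Ω → E, (∀ t, Measurable (Y t)) →
      P.map (fun ω => I.restrict (Y · ω)) = (P.map (trunc I Y)).map I.restrict := by
    intro Y hY
    rw [Measure.map_map (Finset.measurable_restrict I) (htrunc I Y hY)]
    congr 1
    ext ω r
    simp [trunc, r.2]
  rw [hres Y hY, hres Z hZ, hmap]

end Independence

section LevyPath

section Functional

variable {E V : Type*} [NormedAddCommGroup E] [MeasurableSpace E] [MeasurableSpace V]

/-- A functional of càdlàg paths which is measurable and depends only on the path up to time `h`. -/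
structure IsPathFunctional (h : ℝ) (G : (ℝ → E) → V) : Prop where
  measurable : Measurable fun z : {z : ℝ → E // IsCadlag z} => G z
  apply_stopPath : ∀ z, IsCadlag z → G (stopPath h z) = G z

variable {Ω : Type*} {h : ℝ} {G : (ℝ → E) → V}

lemma IsPathFunctional.comp {V' : Type*} [MeasurableSpace V'] (hG : IsPathFunctional h G)
    {φ : V → V'} (hφ : Measurable φ) : IsPathFunctional h fun z => φ (G z) :=
  ⟨hφ.comp hG.measurable, fun z hz => by rw [hG.apply_stopPath z hz]⟩

lemma IsPathFunctional.prodMk {V' : Type*} [MeasurableSpace V'] {G' : (ℝ → E) → V'}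
    (hG : IsPathFunctional h G) (hG' : IsPathFunctional h G') :
    IsPathFunctional h fun z => (G z, G' z) :=
  ⟨hG.measurable.prodMk hG'.measurable, fun z hz => by
    rw [hG.apply_stopPath z hz, hG'.apply_stopPath z hz]⟩

lemma IsPathFunctional.measurable_comp [MeasurableSpace Ω] (hG : IsPathFunctional h G)
    {Y : Ω → ℝ → E} (hY : Measurable Y) (hc : ∀ ω, IsCadlag (Y ω)) :
    Measurable fun ω => G (Y ω) :=
  hG.measurable.comp (hY.subtype_mk (h := hc))

lemma IsPathFunctional.comap_le (hG : IsPathFunctional h G) {Y : Ω → ℝ → E}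
    (hc : ∀ ω, IsCadlag (Y ω)) :
    MeasurableSpace.comap (fun ω => G (Y ω)) inferInstance ≤
      MeasurableSpace.comap Y inferInstance := by
  let _ := MeasurableSpace.comap Y inferInstance
  exact (hG.measurable_comp (comap_measurable Y) hc).comap_le

lemma IsPathFunctional.map_eq [MeasurableSpace Ω] {P : Measure Ω} (hG : IsPathFunctional h G)
    {Y Z : Ω → ℝ → E} (hY : Measurable Y) (hZ : Measurable Z) (hYc : ∀ ω, IsCadlag (Y ω))
    (hZc : ∀ ω, IsCadlag (Z ω)) (hYZ : P.map Y = P.map Z) :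
    P.map (fun ω => G (Y ω)) = P.map fun ω => G (Z ω) := by
  have hsub : P.map (fun ω => (⟨Y ω, hYc ω⟩ : {z : ℝ → E // IsCadlag z})) =
      P.map fun ω => ⟨Z ω, hZc ω⟩ := by
    ext s hs
    obtain ⟨S, hS, rfl⟩ := hs
    rw [Measure.map_apply hY.subtype_mk (measurable_subtype_coe hS),
      Measure.map_apply hZ.subtype_mk (measurable_subtype_coe hS)]
    have := congrArg (fun μ => μ S) hYZ
    rwa [Measure.map_apply hY hS, Measure.map_apply hZ hS] at this
  have := congrArg (Measure.map fun z : {z : ℝ → E // IsCadlag z} => G z) hsub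
  rwa [Measure.map_map hG.measurable hY.subtype_mk,
    Measure.map_map hG.measurable hZ.subtype_mk] at this

lemma comap_pi_le {ι α : Type*} [MeasurableSpace α] {m : MeasurableSpace Ω} {f : Ω → ι → α}
    (hf : ∀ i, Measurable[m] fun ω => f ω i) : MeasurableSpace.comap f inferInstance ≤ m :=
  (measurable_pi_lambda _ hf).comap_le

/-- The σ-algebra generated by a process up to time `t`. -/
abbrev pastSigma {α : Type*} [MeasurableSpace α] (X : ℝ → Ω → α) (t : ℝ) : MeasurableSpace Ω :=
  MeasurableSpace.comap (fun ω (r : {r : ℝ // 0 ≤ r ∧ r ≤ t}) => X r ω) inferInstance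

lemma measurable_pastSigma {α : Type*} [MeasurableSpace α] (X : ℝ → Ω → α) {r t : ℝ} (hr : 0 ≤ r)
    (hrt : r ≤ t) : Measurable[pastSigma X t] (X r) := by
  let _ := pastSigma X t
  exact (measurable_pi_apply (⟨r, hr, hrt⟩ : {r : ℝ // 0 ≤ r ∧ r ≤ t})).comp
    (comap_measurable fun ω (r : {r : ℝ // 0 ≤ r ∧ r ≤ t}) => X r ω)

lemma pastSigma_le {α : Type*} [MeasurableSpace α] {X : ℝ → Ω → α} {t : ℝ}
    {m : MeasurableSpace Ω} (hm : ∀ r, 0 ≤ r → r ≤ t → Measurable[m] (X r)) :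
    pastSigma X t ≤ m :=
  comap_pi_le fun r => hm r r.2.1 r.2.2

lemma pastSigma_mono {α : Type*} [MeasurableSpace α] (X : ℝ → Ω → α) {s t : ℝ} (hst : s ≤ t) :
    pastSigma X s ≤ pastSigma X t :=
  pastSigma_le fun _ hr hrs => measurable_pastSigma X hr (hrs.trans hst)

lemma measurable_shiftPath [MeasurableSub₂ E] {m : MeasurableSpace Ω} {X : ℝ → Ω → E} {t : ℝ}
    (ht : 0 ≤ t) (hX : ∀ r, 0 ≤ r → Measurable[m] (X r)) :
    Measurable[m] fun ω => shiftPath t (X · ω) :=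
  measurable_pi_lambda _ fun _ => (hX _ (add_nonneg ht (le_max_right _ _))).sub (hX t ht)

lemma IsPathFunctional.measurable_past (hG : IsPathFunctional h G) [MeasurableSub₂ E]
    {X : ℝ → Ω → E}
    (hc : ∀ ω, IsCadlag (X · ω))
    (hh : 0 ≤ h) {t u : ℝ} (hu : 0 ≤ u) (hut : u + h ≤ t) :
    Measurable[pastSigma X t] fun ω => G (shiftPath u (X · ω)) := by
  have hcs := fun ω => (hc ω).shiftPath hu
  have heq : (fun ω => G (shiftPath u (X · ω))) =
      fun ω => G (stopPath h (shiftPath u (X · ω))) :=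
    funext fun ω => (hG.apply_stopPath _ (hcs ω)).symm
  rw [heq]
  let _ := pastSigma X t
  refine hG.measurable_comp (measurable_pi_lambda _ fun r => ?_) fun ω => (hcs ω).stopPath h
  have h1 : max 0 (min r h) ≤ h := max_le hh (min_le_right _ _)
  exact (measurable_pastSigma X (by positivity)
    (by rw [max_eq_left (le_max_left _ _)]; linarith)).sub
      (measurable_pastSigma X hu (by linarith))

end Functional

variable {Ω : Type*} [mΩ : MeasurableSpace Ω] {P : Measure Ω} {n : ℕ}
  {X : ℝ → Ω → EuclideanSpace ℝ (Fin n)}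

/-- The increments of a Lévy process after time `t` are independent of its past. -/
lemma IsLevyProcess.indep_shiftPath (hX : IsLevyProcess P X) {t : ℝ} (ht : 0 ≤ t) :
    IndepFun (fun ω => shiftPath t (X · ω))
      (fun ω => fun r : {r : ℝ // 0 ≤ r ∧ r ≤ t} => X r ω) P := by
  have := hX.isProb
  have hpast : ∀ t, pastSigma X t ≤ mΩ := fun t => pastSigma_le fun r _ _ => hX.meas r
  have key := indep_iSup_of_increments (P := P)
    (A₁ := fun s : NNReal => MeasurableSpace.comap (fun ω => X (t + s) ω - X t ω) inferInstance)
    (A₂ := fun _ => pastSigma X t)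
    (W₁ := fun s u => MeasurableSpace.comap (fun ω => X (t + u) ω - X (t + s) ω) inferInstance)
    (W₂ := fun _ _ => ⊥) (fun s => ((hX.meas _).sub (hX.meas _)).comap_le) (fun _ => hpast t)
    (fun s u => ((hX.meas _).sub (hX.meas _)).comap_le) (fun _ _ => bot_le) ?_
    (fun _ _ _ => le_sup_left) ?_ (fun _ _ _ => indep_bot_right _) ?_
  · rw [IndepFun_iff_Indep]
    refine indep_of_indep_of_le key ?_ (le_iSup (fun _ : NNReal => pastSigma X t) 0)
    refine comap_pi_le fun r => ?_
    exact (comap_measurable _).mono (le_iSup (fun s : NNReal =>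
      MeasurableSpace.comap (fun ω => X (t + s) ω - X t ω) inferInstance)
      ⟨max r 0, le_max_right _ _⟩) le_rfl
  · intro s u _
    set m := MeasurableSpace.comap (fun ω => X (t + s) ω - X t ω) inferInstance ⊔
      MeasurableSpace.comap (fun ω => X (t + u) ω - X (t + s) ω) inferInstance with hm
    have h1 : Measurable[m] fun ω => X (t + s) ω - X t ω :=
      (comap_measurable _).mono le_sup_left le_rfl
    have h2 : Measurable[m] fun ω => X (t + u) ω - X (t + s) ω :=
      (comap_measurable _).mono le_sup_right le_rfl
    refine Measurable.comap_le ?_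
    convert h1.add h2 using 1
    ext1 ω
    simp
  · have : (fun ω => X (t + (0 : NNReal)) ω - X t ω) = fun _ => 0 := by
      ext1 ω
      simp
    rw [this, MeasurableSpace.comap_const]
    exact indep_bot_left _
  · intro s u hsu
    have h := (hX.indep (u - s) (t + s) (sub_nonneg.2 (by exact_mod_cast hsu)) (by positivity)).symm
    rw [IndepFun_iff_Indep, show t + (s : ℝ) + (u - s) = t + u by ring] at h
    rw [sup_bot_eq]
    refine indep_of_indep_of_le_left h (iSup₂_le fun r hr => sup_le ?_ (pastSigma_mono X (by simp)))
    refine Measurable.comap_le ?_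
    have hr' : (r : ℝ) ≤ s := by exact_mod_cast hr
    exact (measurable_pastSigma X (by positivity) (by linarith)).sub
      (measurable_pastSigma X ht (by simp))

/-- The law of the increments of a Lévy process after time `t` does not depend on `t`. -/
lemma IsLevyProcess.map_shiftPath (hX : IsLevyProcess P X) {t : ℝ} (ht : 0 ≤ t) :
    P.map (fun ω => shiftPath t (X · ω)) = P.map fun ω => shiftPath 0 (X · ω) := by
  have := hX.isProb
  have hi : ∀ t : ℝ, 0 ≤ t → ∀ s u : NNReal, s ≤ u →
      IndepFun (fun ω => (X (t + u) ω - X t ω) - (X (t + s) ω - X t ω))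
        (fun ω (r : Set.Iic s) => X (t + (r : NNReal)) ω - X t ω) P := by
    intro t ht s u hsu
    have h := hX.indep (u - s) (t + s) (sub_nonneg.2 (by exact_mod_cast hsu)) (by positivity)
    simp only [sub_sub_sub_cancel_right]
    rw [IndepFun_iff_Indep, show t + (s : ℝ) + (u - s) = t + u by ring] at h
    refine indep_of_indep_of_le_right h
      (comap_pi_le fun r => ?_)
    have hr' : ((r : NNReal) : ℝ) ≤ s := by exact_mod_cast r.2
    exact (measurable_pastSigma X (by positivity) (by linarith)).sub
      (measurable_pastSigma X ht (by simp))
  have hs : ∀ t : ℝ, 0 ≤ t → ∀ s u : NNReal, s ≤ u →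
      P.map (fun ω => (X (t + u) ω - X t ω) - (X (t + s) ω - X t ω)) = P.map (X (u - s)) := by
    intro t ht s u hsu
    have h := hX.stat (u - s) (t + s) (sub_nonneg.2 (by exact_mod_cast hsu)) (by positivity)
    rw [show t + (s : ℝ) + (u - s) = t + u by ring] at h
    simpa only [sub_sub_sub_cancel_right] using h
  have hmeas : ∀ (t : ℝ) (s : NNReal), Measurable fun ω => X (t + s) ω - X t ω :=
    fun t s => (hX.meas _).sub (hX.meas _)
  have key := map_eq_of_increments (P := P) (Y := fun (s : NNReal) ω => X (t + s) ω - X t ω)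
    (Z := fun (s : NNReal) ω => X (0 + s) ω - X 0 ω) (hmeas t) (hmeas 0) (by simp) (by simp)
    (fun s u hsu => by rw [hs t ht s u hsu, hs 0 le_rfl s u hsu]) (hi t ht) (hi 0 le_rfl)
  let g : (NNReal → EuclideanSpace ℝ (Fin n)) → ℝ → EuclideanSpace ℝ (Fin n) :=
    fun p r => p r.toNNReal
  have hg : Measurable g := measurable_pi_lambda _ fun r => measurable_pi_apply _
  have := congrArg (Measure.map g) key
  rw [Measure.map_map hg (measurable_pi_lambda _ (hmeas t)),
    Measure.map_map hg (measurable_pi_lambda _ (hmeas 0))] at this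
  exact this

variable {V : Type*} [MeasurableSpace V] {h : ℝ} {G : (ℝ → EuclideanSpace ℝ (Fin n)) → V}

lemma IsLevyProcess.indep_functional (hX : IsLevyProcess P X) (hc : ∀ ω, IsCadlag (X · ω))
    (hG : IsPathFunctional h G) {t : ℝ} (ht : 0 ≤ t) :
    Indep (MeasurableSpace.comap (fun ω => G (shiftPath t (X · ω))) inferInstance)
      (pastSigma X t) P :=
  indep_of_indep_of_le_left (hX.indep_shiftPath ht) (hG.comap_le fun ω => (hc ω).shiftPath ht)

lemma IsLevyProcess.map_functional (hX : IsLevyProcess P X) (hc : ∀ ω, IsCadlag (X · ω))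
    (hG : IsPathFunctional h G) {t : ℝ} (ht : 0 ≤ t) :
    P.map (fun ω => G (shiftPath t (X · ω))) = P.map fun ω => G (shiftPath 0 (X · ω)) :=
  hG.map_eq (measurable_shiftPath ht fun r _ => hX.meas r)
    (measurable_shiftPath le_rfl fun r _ => hX.meas r) (fun ω => (hc ω).shiftPath ht)
    (fun ω => (hc ω).shiftPath le_rfl) (hX.map_shiftPath ht)

lemma IsLevyProcess.integral_prod_functional (hX : IsLevyProcess P X)
    (hc : ∀ ω, IsCadlag (X · ω)) {g : (ℝ → EuclideanSpace ℝ (Fin n)) → ℂ}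
    (hg : IsPathFunctional h g) (hh : 0 ≤ h) (m : ℕ) :
    ∫ ω, ∏ k ∈ Finset.range m, g (shiftPath (k * h) (X · ω)) ∂P =
      (∫ ω, g (shiftPath 0 (X · ω)) ∂P) ^ m := by
  have := hX.isProb
  have hpast : ∀ t, pastSigma X t ≤ mΩ := fun t => pastSigma_le fun r _ _ => hX.meas r
  have hgm : ∀ t : ℝ, 0 ≤ t → Measurable fun ω => g (shiftPath t (X · ω)) := fun t ht =>
    (hg.measurable_past hc hh ht le_rfl).mono (hpast _) le_rfl
  induction m with
  | zero => simp
  | succ m ih =>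
    have hm : (0 : ℝ) ≤ m * h := by positivity
    have h1 : Measurable[pastSigma X (m * h)]
        fun ω => ∏ k ∈ Finset.range m, g (shiftPath (k * h) (X · ω)) := by
      refine Finset.measurable_fun_prod _ fun k hk => hg.measurable_past hc hh (by positivity) ?_
      have : (k + 1 : ℝ) ≤ m := by exact_mod_cast Finset.mem_range.1 hk
      nlinarith
    have hind : IndepFun (fun ω => ∏ k ∈ Finset.range m, g (shiftPath (k * h) (X · ω)))
        (fun ω => g (shiftPath (m * h) (X · ω))) P := by
      rw [IndepFun_iff_Indep]
      exact (indep_of_indep_of_le_right (hX.indep_functional hc hg hm) h1.comap_le).symm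
    have hlaw : ∫ ω, g (shiftPath (m * h) (X · ω)) ∂P = ∫ ω, g (shiftPath 0 (X · ω)) ∂P := by
      rw [← integral_map (f := fun x : ℂ => x) (hgm _ hm).aemeasurable (by fun_prop),
        hX.map_functional hc hg hm, integral_map (hgm 0 le_rfl).aemeasurable (by fun_prop)]
    simp_rw [Finset.prod_range_succ]
    rw [hind.integral_fun_mul_eq_mul_integral
      (h1.mono (hpast _) le_rfl).aestronglyMeasurable (hgm _ hm).aestronglyMeasurable, ih, hlaw,
      pow_succ]

end LevyPath

section NoJump

variable {E V : Type*} [NormedAddCommGroup E] [NormedAddCommGroup V] {f f₁ f₂ : E → V} {ε : ℝ}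

/-- Up to time `h`, the path has no jump at which `f` is nonzero. -/
def NoJump (f : E → V) (h : ℝ) (z : ℝ → E) : Prop := ∀ s ∈ Set.Ioc 0 h, f (jump z s) = 0

lemma NoJump.jumpSum_eq_zero {h : ℝ} {z : ℝ → E} (hz : NoJump f h z) : jumpSum f h z = 0 :=
  finsum_mem_eq_zero_of_forall_eq_zero hz

lemma IsCadlag.jumpSum_norm_eq_zero_iff {z : ℝ → E} (hz : IsCadlag z) (hε : 0 < ε)
    (hf : ∀ x, ‖x‖ < ε → f x = 0) {h : ℝ} : jumpSum (fun x => ‖f x‖) h z = 0 ↔ NoJump f h z := by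
  refine ⟨fun h0 s hs => ?_, fun h0 => finsum_mem_eq_zero_of_forall_eq_zero fun s hs =>
    norm_eq_zero.2 (h0 s hs)⟩
  rw [hz.jumpSum_eq_sum hε (fun x hx => by rw [hf x hx, norm_zero]),
    Finset.sum_eq_zero_iff_of_nonneg fun _ _ => norm_nonneg _] at h0
  by_contra hne
  refine hne (norm_eq_zero.1 (h0 s ?_))
  exact (Set.Finite.mem_toFinset _).2 ⟨hs, not_lt.1 fun h => hne (hf _ h)⟩

lemma IsCadlag.noJump_shiftPath_iff {z : ℝ → E} (hz : IsCadlag z) {t h : ℝ} (ht : 0 ≤ t) :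
    NoJump f h (_root_.shiftPath t z) ↔ ∀ s ∈ Set.Ioc 0 h, f (jump z (t + s)) = 0 :=
  forall₂_congr fun s hs => by rw [hz.jump_shiftPath ht hs.1]

lemma IsCadlag.noJump_mul_iff {z : ℝ → E} (hz : IsCadlag z) {h : ℝ} (hh : 0 < h) (m : ℕ) :
    NoJump f (m * h) z ↔ ∀ k < m, NoJump f h (_root_.shiftPath (k * h) z) := by
  constructor
  · intro H k hk
    rw [hz.noJump_shiftPath_iff (by positivity)]
    intro s hs
    have : (k + 1 : ℝ) ≤ m := by exact_mod_cast hk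
    exact H _ ⟨add_pos_of_nonneg_of_pos (by positivity) hs.1, by nlinarith [hs.2]⟩
  · intro H s hs
    obtain ⟨k, hk, hk'⟩ := exists_grid_index hh hs.1
    have hkm : k < m := by
      have := lt_of_mul_lt_mul_right (hk.trans_le hs.2) hh.le
      exact_mod_cast this
    have := (hz.noJump_shiftPath_iff (by positivity)).1 (H k hkm) (s - k * h)
      ⟨by linarith, by linarith⟩
    rwa [add_sub_cancel] at this

lemma IsCadlag.eventually_noJump {z : ℝ → E} (hz : IsCadlag z) (hε : 0 < ε)
    (hf : ∀ x, ‖x‖ < ε → f x = 0) : ∀ᶠ h in 𝓝 0, NoJump f h z := by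
  have hfin := hz.finite_jumps hε 1
  obtain ⟨δ, hδ, h⟩ := Metric.isOpen_iff.1 hfin.isClosed.isOpen_compl (0 : ℝ)
    (fun h0 => lt_irrefl _ h0.1.1)
  filter_upwards [gt_mem_nhds hδ, gt_mem_nhds one_pos] with r hr hr' s hs
  have hs' : s ∈ Metric.ball (0 : ℝ) δ := by
    rw [mem_ball_zero_iff, Real.norm_of_nonneg hs.1.le]
    exact hs.2.trans_lt hr
  exact hf _ (not_le.1 fun hj => h hs' ⟨⟨hs.1, hs.2.trans (le_of_lt hr')⟩, hj⟩)

/-- On a fine grid, no cell contains both jumps at which `f₁` is nonzero and jumps at which `f₂` is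
nonzero. -/
lemma IsCadlag.eventually_noJump_or {z : ℝ → E} (hz : IsCadlag z) (hε : 0 < ε)
    (hf₁ : ∀ x, ‖x‖ < ε → f₁ x = 0) (hf₂ : ∀ x, ‖x‖ < ε → f₂ x = 0)
    (hd : ∀ x, f₁ x = 0 ∨ f₂ x = 0) {t : ℝ} (ht : 0 < t) :
    ∀ᶠ m : ℕ in atTop, ∀ k < m, NoJump f₁ (t / m) (_root_.shiftPath (k * (t / m)) z) ∨
      NoJump f₂ (t / m) (_root_.shiftPath (k * (t / m)) z) := by
  obtain ⟨δ, hδ, h⟩ := exists_separation (hz.finite_jumps hε t)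
  filter_upwards [(tendsto_mesh t).eventually (gt_mem_nhds hδ), eventually_gt_atTop 0]
    with m hm hm0 k hk
  have hm0' : (0 : ℝ) < m := by exact_mod_cast hm0
  have hkm : (k + 1 : ℝ) ≤ m := by exact_mod_cast hk
  have hmt : m * (t / m) = t := by field_simp
  set r := t / m with hr
  have hr0 : 0 < r := by positivity
  rw [hz.noJump_shiftPath_iff (by positivity), hz.noJump_shiftPath_iff (by positivity)]
  by_contra! hcon
  obtain ⟨⟨s, hs, hs1⟩, ⟨s', hs', hs2⟩⟩ := hcon
  have hmem : ∀ s ∈ Set.Ioc 0 r, k * r + s ∈ Set.Ioc 0 t := fun s hs =>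
    ⟨add_pos_of_nonneg_of_pos (by positivity) hs.1, by nlinarith [hs.2]⟩
  have hne : k * r + s ≠ k * r + s' := by
    intro heq
    rw [heq] at hs1
    exact (hd _).elim hs1 hs2
  have := h _ ⟨hmem s hs, not_lt.1 fun hl => hs1 (hf₁ _ hl)⟩ _
    ⟨hmem s' hs', not_lt.1 fun hl => hs2 (hf₂ _ hl)⟩ hne
  rw [add_sub_add_left_eq_sub] at this
  refine absurd (abs_lt.2 ⟨?_, ?_⟩) (not_lt.2 this)
  · linarith [hs.1, hs'.2]
  · linarith [hs.2, hs'.1]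

lemma IsCadlag.jumpSum_mul {z : ℝ → E} (hz : IsCadlag z) (hε : 0 < ε)
    (hf : ∀ x, ‖x‖ < ε → f x = 0) {h : ℝ} (hh : 0 ≤ h) (m : ℕ) :
    jumpSum f (m * h) z = ∑ k ∈ Finset.range m, jumpSum f h (_root_.shiftPath (k * h) z) := by
  induction m with
  | zero => simp [jumpSum_of_nonpos]
  | succ m ih =>
    rw [Finset.sum_range_succ, ← ih, Nat.cast_succ, add_one_mul,
      hz.jumpSum_add_time hε hf hh (by positivity)]

variable [MeasurableSpace E] [BorelSpace E] [SecondCountableTopology E]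

lemma isPathFunctional_jumpSum [NormedSpace ℝ V] [MeasurableSpace V] [BorelSpace V]
    [SecondCountableTopology V] (hfm : Measurable f) (hε : 0 < ε) (hf : ∀ x, ‖x‖ < ε → f x = 0)
    {r h : ℝ} (hr : r ≤ h) : IsPathFunctional h (jumpSum f r) :=
  ⟨measurable_jumpSum (fun z : {z : ℝ → E // IsCadlag z} => z.2)
    (fun s _ => (measurable_pi_apply s).comp measurable_subtype_coe) hfm hε hf r,
    fun _ hz => hz.jumpSum_stopPath hr f⟩

lemma isPathFunctional_noJump [MeasurableSpace V] [BorelSpace V] (hfm : Measurable f) (hε : 0 < ε)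
    (hf : ∀ x, ‖x‖ < ε → f x = 0) (h : ℝ) : IsPathFunctional h (NoJump f h) := by
  have hf' : ∀ x, ‖x‖ < ε → ‖f x‖ = 0 := fun x hx => by rw [hf x hx, norm_zero]
  have hG := isPathFunctional_jumpSum hfm.norm hε hf' (le_refl h)
  refine ⟨?_, fun z hz => ?_⟩
  · simp_rw [← fun z : {z : ℝ → E // IsCadlag z} =>
      propext (z.2.jumpSum_norm_eq_zero_iff hε hf (h := h))]
    exact measurableSet_setOfPred.1 (hG.measurable (measurableSet_singleton (0 : ℝ)))
  · rw [← hz.jumpSum_norm_eq_zero_iff hε hf, ← (hz.stopPath h).jumpSum_norm_eq_zero_iff hε hf,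
      hG.apply_stopPath z hz]

end NoJump

section JumpLevy

variable {Ω : Type*} {n d : ℕ}
  {X : ℝ → Ω → EuclideanSpace ℝ (Fin n)}
  {f : EuclideanSpace ℝ (Fin n) → EuclideanSpace ℝ (Fin d)} {ε : ℝ}

lemma pastSigma_jumpSum_le (hc : ∀ ω, IsCadlag (X · ω)) (hfm : Measurable f) (hε : 0 < ε)
    (hf : ∀ x, ‖x‖ < ε → f x = 0) {t : ℝ} (ht : 0 ≤ t) :
    pastSigma (fun r ω => jumpSum f r (X · ω)) t ≤ pastSigma X t := by
  refine pastSigma_le fun r _ hrt => ?_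
  have := (isPathFunctional_jumpSum hfm hε hf hrt).measurable_past hc ht le_rfl (zero_add t).le
  simpa only [(hc _).jumpSum_shiftPath_zero] using this

variable [MeasurableSpace Ω] {P : Measure Ω}

lemma tendsto_measureReal_of_eventually [IsProbabilityMeasure P] {ι : Type*} {l : Filter ι}
    [l.IsCountablyGenerated] {p : ι → Ω → Prop} (hp : ∀ i, MeasurableSet {ω | p i ω})
    (h : ∀ ω, ∀ᶠ i in l, p i ω) : Tendsto (fun i => P.real {ω | p i ω}) l (𝓝 1) := by
  have := tendsto_measure_of_tendsto_indicator_of_isFiniteMeasure (μ := P) l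
    (As := fun i => {ω | p i ω}) (A := Set.univ) hp (fun ω => ?_)
  · simpa [Function.comp_def, Measure.real] using
      (ENNReal.tendsto_toReal (measure_ne_top P Set.univ)).comp this
  · filter_upwards [h ω] with i hi
    simpa using hi

/-- Sums over the jumps of a càdlàg Lévy process form a Lévy process. -/
theorem IsLevyProcess.isLevyProcess_jumpSum (hX : IsLevyProcess P X) (hc : ∀ ω, IsCadlag (X · ω))
    (hfm : Measurable f) (hε : 0 < ε) (hf : ∀ x, ‖x‖ < ε → f x = 0) :
    IsLevyProcess P fun t ω => jumpSum f t (X · ω) := by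
  have := hX.isProb
  have hmeas : ∀ t, Measurable fun ω => jumpSum f t (X · ω) :=
    measurable_jumpSum hc (fun r _ => hX.meas r) hfm hε hf
  have hinc : ∀ s t : ℝ, 0 ≤ s → 0 ≤ t →
      (fun ω => jumpSum f (t + s) (X · ω) - jumpSum f t (X · ω)) =
        fun ω => jumpSum f s (shiftPath t (X · ω)) := fun s t hs ht =>
    funext fun ω => by rw [(hc ω).jumpSum_add_time hε hf hs ht, add_sub_cancel_left]
  have hstat : ∀ s t : ℝ, 0 ≤ s → 0 ≤ t →
      P.map (fun ω => jumpSum f (t + s) (X · ω) - jumpSum f t (X · ω)) =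
        P.map fun ω => jumpSum f s (X · ω) := by
    intro s t hs ht
    rw [hinc s t hs ht,
      hX.map_functional hc (isPathFunctional_jumpSum hfm hε hf (le_refl s)) ht]
    simp only [(hc _).jumpSum_shiftPath_zero]
  refine ⟨hX.isProb, hmeas, ?_, fun s t hs ht => ?_, hstat, fun t ht η hη => ?_⟩
  · simp [jumpSum_of_nonpos]
  · rw [hinc s t hs ht, IndepFun_iff_Indep]
    exact indep_of_indep_of_le_right
      (hX.indep_functional hc (isPathFunctional_jumpSum hfm hε hf (le_refl s)) ht)
      (pastSigma_jumpSum_le hc hfm hε hf ht)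
  · have hlarge : MeasurableSet {x : EuclideanSpace ℝ (Fin d) | η ≤ ‖x‖} :=
      measurableSet_le measurable_const measurable_norm
    have hdiff : ∀ u v : ℝ, 0 ≤ u → u ≤ v →
        P {ω | η ≤ ‖jumpSum f v (X · ω) - jumpSum f u (X · ω)‖} =
          P {ω | η ≤ ‖jumpSum f (v - u) (X · ω)‖} := by
      intro u v hu huv
      have h := congrArg (fun μ => μ {x | η ≤ ‖x‖}) (hstat (v - u) u (sub_nonneg.2 huv) hu)
      have hsub : Measurable fun ω => jumpSum f v (X · ω) - jumpSum f u (X · ω) :=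
        (hmeas v).sub (hmeas u)
      rw [add_sub_cancel, Measure.map_apply hsub hlarge, Measure.map_apply (hmeas _) hlarge] at h
      exact h
    have heq : ∀ s ∈ Set.Ici (0 : ℝ),
        P {ω | η ≤ ‖jumpSum f |s - t| (X · ω)‖} =
          P {ω | η ≤ ‖jumpSum f s (X · ω) - jumpSum f t (X · ω)‖} := by
      intro s hs
      rcases le_total t s with hts | hst
      · rw [hdiff t s ht hts, abs_of_nonneg (sub_nonneg.2 hts)]
      · simp_rw [norm_sub_rev (jumpSum f s _)]
        rw [hdiff s t hs hst, abs_of_nonpos (sub_nonpos.2 hst), neg_sub]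
    have hlim : Tendsto (fun r : ℝ => P {ω | η ≤ ‖jumpSum f r (X · ω)‖}) (𝓝 0) (𝓝 0) := by
      have := tendsto_measure_of_tendsto_indicator_of_isFiniteMeasure (μ := P) (𝓝 (0 : ℝ))
        (As := fun r => {ω | η ≤ ‖jumpSum f r (X · ω)‖}) (A := ∅)
        (fun r => hmeas r hlarge) (fun ω => ?_)
      · simpa using this
      · filter_upwards [(hc ω).eventually_noJump hε hf] with r hr
        simp [hr.jumpSum_eq_zero, hη]
    have habs : Tendsto (fun s : ℝ => |s - t|) (𝓝[Set.Ici 0] t) (𝓝 0) := by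
      have : Continuous fun s : ℝ => |s - t| := by fun_prop
      simpa using (this.tendsto t).mono_left (nhdsWithin_le_nhds (s := Set.Ici 0))
    refine (hlim.comp habs).congr' ?_
    filter_upwards [self_mem_nhdsWithin] with s hs using heq s hs

end JumpLevy

section Factorization

lemma mul_one_sub_le_neg_log_pow {x : ℝ} (hx : 0 < x) (m : ℕ) :
    m * (1 - x) ≤ -Real.log (x ^ m) := by
  rw [Real.log_pow, ← mul_neg]
  exact mul_le_mul_of_nonneg_left (by linarith [Real.log_le_sub_one_of_pos hx]) m.cast_nonneg

lemma norm_pow_sub_pow_le {R : Type*} [NormedRing R] [NormOneClass R] {a b : R} (ha : ‖a‖ ≤ 1)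
    (hb : ‖b‖ ≤ 1) (m : ℕ) : ‖a ^ m - b ^ m‖ ≤ m * ‖a - b‖ := by
  induction m with
  | zero => simp
  | succ m ih =>
    have h : a ^ (m + 1) - b ^ (m + 1) = a ^ m * (a - b) + (a ^ m - b ^ m) * b := by
      rw [pow_succ, pow_succ]
      noncomm_ring
    rw [h]
    have h1 : ‖a ^ m * (a - b)‖ ≤ ‖a - b‖ := (norm_mul_le _ _).trans
      (mul_le_of_le_one_left (norm_nonneg _)
        ((norm_pow_le a m).trans (pow_le_one₀ (norm_nonneg _) ha)))
    have h2 : ‖(a ^ m - b ^ m) * b‖ ≤ m * ‖a - b‖ := (norm_mul_le _ _).trans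
      ((mul_le_of_le_one_right (norm_nonneg _) hb).trans ih)
    refine (norm_add_le _ _).trans ?_
    push_cast
    linarith

variable {Ω : Type*} [MeasurableSpace Ω] {P : Measure Ω} {n d : ℕ}
  {X : ℝ → Ω → EuclideanSpace ℝ (Fin n)}

lemma IsLevyProcess.measureReal_forall_functional (hX : IsLevyProcess P X)
    (hc : ∀ ω, IsCadlag (X · ω)) {h : ℝ} {p : (ℝ → EuclideanSpace ℝ (Fin n)) → Prop}
    (hp : IsPathFunctional h p) (hh : 0 ≤ h) (m : ℕ) :
    P.real {ω | ∀ k < m, p (shiftPath (k * h) (X · ω))} =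
      P.real {ω | p (shiftPath 0 (X · ω))} ^ m := by
  classical
  have := hX.isProb
  have hmeas : ∀ t : ℝ, 0 ≤ t → MeasurableSet {ω | p (shiftPath t (X · ω))} := fun t ht =>
    measurableSet_setOfPred.2 (hp.measurable_comp (measurable_shiftPath ht fun r _ => hX.meas r)
      fun ω => (hc ω).shiftPath ht)
  have hg : IsPathFunctional h fun z => if p z then (1 : ℂ) else 0 :=
    hp.comp (φ := fun q : Prop => if q then (1 : ℂ) else 0) measurable_from_top
  have hind : ∀ (q : Ω → Prop) [DecidablePred q], MeasurableSet {ω | q ω} →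
      ∫ ω, (if q ω then (1 : ℂ) else 0) ∂P = (P.real {ω | q ω} : ℂ) := by
    intro q _ hq
    have := integral_indicator_const (μ := P) (1 : ℂ) hq
    rw [Complex.real_smul, mul_one] at this
    rw [← this]
    exact integral_congr_ae (ae_of_all _ fun ω => by simp [Set.indicator_apply])
  have key := hX.integral_prod_functional hc hg hh m
  rw [hind _ (hmeas 0 le_rfl)] at key
  have hprod : ∀ ω, (∏ k ∈ Finset.range m, if p (shiftPath (k * h) (X · ω)) then (1 : ℂ) else 0) =
      if ∀ k < m, p (shiftPath (k * h) (X · ω)) then 1 else 0 := fun ω => by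
    simp [Finset.prod_ite_zero]
  simp_rw [hprod] at key
  have hall : MeasurableSet {ω | ∀ k < m, p (shiftPath (k * h) (X · ω))} := by
    have : {ω | ∀ k < m, p (shiftPath (k * h) (X · ω))} =
        ⋂ k ∈ Finset.range m, {ω | p (shiftPath (k * h) (X · ω))} := by
      ext ω
      simp
    rw [this]
    exact Finset.measurableSet_biInter _ fun k _ => hmeas _ (by positivity)
  rw [hind _ hall] at key
  exact_mod_cast key

variable {V : Type*} [NormedAddCommGroup V] [MeasurableSpace V] [BorelSpace V]
  {f f₁ f₂ : EuclideanSpace ℝ (Fin n) → V} {ε : ℝ}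

lemma IsLevyProcess.tendsto_noJump (hX : IsLevyProcess P X) (hc : ∀ ω, IsCadlag (X · ω))
    (hfm : Measurable f) (hε : 0 < ε) (hf : ∀ x, ‖x‖ < ε → f x = 0) (t : ℝ) :
    Tendsto (fun m : ℕ => P.real {ω | NoJump f (t / m) (shiftPath 0 (X · ω))}) atTop (𝓝 1) := by
  have := hX.isProb
  refine tendsto_measureReal_of_eventually (fun m => measurableSet_setOfPred.2 ?_) fun ω => ?_
  · exact (isPathFunctional_noJump hfm hε hf _).measurable_comp
      (measurable_shiftPath le_rfl fun r _ => hX.meas r) fun ω => (hc ω).shiftPath le_rfl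
  · exact (tendsto_mesh t).eventually (((hc ω).shiftPath le_rfl).eventually_noJump hε hf)

/-- The probability of a jump during a time `t / m` is of order at most `1 / m`. -/
lemma IsLevyProcess.exists_mul_prob_jump_le (hX : IsLevyProcess P X)
    (hc : ∀ ω, IsCadlag (X · ω)) (hfm : Measurable f) (hε : 0 < ε)
    (hf : ∀ x, ‖x‖ < ε → f x = 0) {t : ℝ} (ht : 0 < t) :
    ∃ C : ℝ, ∀ᶠ m : ℕ in atTop,
      m * (1 - P.real {ω | NoJump f (t / m) (shiftPath 0 (X · ω))}) ≤ C := by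
  refine ⟨-Real.log (P.real {ω | NoJump f t (X · ω)}), ?_⟩
  filter_upwards [(hX.tendsto_noJump hc hfm hε hf t).eventually (lt_mem_nhds one_pos),
    eventually_gt_atTop 0] with m hm hm0
  have hm0' : (0 : ℝ) < m := by exact_mod_cast hm0
  have hmt : m * (t / m) = t := by field_simp
  refine (mul_one_sub_le_neg_log_pow hm m).trans_eq ?_
  rw [← hX.measureReal_forall_functional hc (isPathFunctional_noJump hfm hε hf _) (by positivity)]
  simp_rw [← fun ω => (hc ω).noJump_mul_iff (f := f) (div_pos ht hm0') m, hmt]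

/-- The probability of jumps of two different kinds during a time `t / m` is `o(1 / m)`. -/
lemma IsLevyProcess.tendsto_mul_prob_jumps (hX : IsLevyProcess P X)
    (hc : ∀ ω, IsCadlag (X · ω)) (hfm₁ : Measurable f₁) (hfm₂ : Measurable f₂) (hε : 0 < ε)
    (hf₁ : ∀ x, ‖x‖ < ε → f₁ x = 0) (hf₂ : ∀ x, ‖x‖ < ε → f₂ x = 0)
    (hd : ∀ x, f₁ x = 0 ∨ f₂ x = 0) {t : ℝ} (ht : 0 < t) :
    Tendsto (fun m : ℕ => m * (1 - P.real {ω | NoJump f₁ (t / m) (shiftPath 0 (X · ω)) ∨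
      NoJump f₂ (t / m) (shiftPath 0 (X · ω))})) atTop (𝓝 0) := by
  have := hX.isProb
  set x : ℕ → ℝ := fun m => P.real {ω | NoJump f₁ (t / m) (shiftPath 0 (X · ω)) ∨
    NoJump f₂ (t / m) (shiftPath 0 (X · ω))} with hx
  have hp : ∀ h, IsPathFunctional h fun z => NoJump f₁ h z ∨ NoJump f₂ h z := fun h =>
    ((isPathFunctional_noJump hfm₁ hε hf₁ h).prodMk (isPathFunctional_noJump hfm₂ hε hf₂ h)).comp
      (φ := fun q : Prop × Prop => q.1 ∨ q.2) (measurable_of_countable _)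
  have hpow : Tendsto (fun m : ℕ => x m ^ m) atTop (𝓝 1) := by
    have := tendsto_measureReal_of_eventually (P := P) (l := atTop) (p := fun (m : ℕ) ω =>
      ∀ k < m, NoJump f₁ (t / m) (shiftPath (k * (t / m)) (X · ω)) ∨
        NoJump f₂ (t / m) (shiftPath (k * (t / m)) (X · ω))) (fun m => ?_)
      (fun ω => (hc ω).eventually_noJump_or hε hf₁ hf₂ hd ht)
    · refine this.congr fun m => ?_
      exact hX.measureReal_forall_functional hc (hp (t / m)) (by positivity) m
    · refine measurableSet_setOfPred.2 (Measurable.forall fun k => Measurable.forall fun _ => ?_)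
      have hk : (0 : ℝ) ≤ k * (t / m) := by positivity
      exact (hp (t / m)).measurable_comp (measurable_shiftPath hk fun r _ => hX.meas r)
        fun ω => (hc ω).shiftPath hk
  have hlog : Tendsto (fun m : ℕ => -Real.log (x m ^ m)) atTop (𝓝 0) := by
    simpa using ((Real.continuousAt_log one_ne_zero).tendsto.comp hpow).neg
  refine squeeze_zero' (Eventually.of_forall fun m => ?_) ?_ hlog
  · exact mul_nonneg m.cast_nonneg (sub_nonneg.2 measureReal_le_one)
  · filter_upwards [hpow.eventually (lt_mem_nhds one_pos), eventually_gt_atTop 0] with m hm hm0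
    refine mul_one_sub_le_neg_log_pow (lt_of_le_of_ne measureReal_nonneg fun h0 => ?_) m
    have h0' : x m = 0 := h0.symm
    rw [h0', zero_pow hm0.ne'] at hm
    exact lt_irrefl _ hm


lemma norm_integral_le_of_eq_zero [IsProbabilityMeasure P] {g : Ω → ℂ} {C : ℝ} {S : Set Ω}
    (hS : MeasurableSet S) (hg : ∀ ω, ‖g ω‖ ≤ C) (h0 : ∀ ω ∈ S, g ω = 0) :
    ‖∫ ω, g ω ∂P‖ ≤ C * (1 - P.real S) := by
  rw [← setIntegral_eq_integral_of_forall_compl_eq_zero (s := Sᶜ)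
    fun ω hω => h0 ω (not_not.1 hω), ← probReal_compl_eq_one_sub hS]
  exact norm_setIntegral_le_of_norm_le_const (measure_lt_top _ _) fun ω _ => hg ω

lemma norm_covariance_le [IsProbabilityMeasure P] {a b : Ω → ℂ} (ha : Measurable a)
    (hb : Measurable b) (ha1 : ∀ ω, ‖a ω‖ = 1) (hb1 : ∀ ω, ‖b ω‖ = 1) {S T : Set Ω}
    (hS : MeasurableSet S) (hT : MeasurableSet T) (haS : ∀ ω ∈ S, a ω = 1)
    (hbT : ∀ ω ∈ T, b ω = 1) :
    ‖∫ ω, a ω * b ω ∂P - (∫ ω, a ω ∂P) * ∫ ω, b ω ∂P‖ ≤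
      4 * (1 - P.real (S ∪ T)) + (2 * (1 - P.real S)) * (2 * (1 - P.real T)) := by
  have hai : Integrable a P := .of_bound ha.aestronglyMeasurable 1 (ae_of_all _ fun ω => (ha1 ω).le)
  have hbi : Integrable b P := .of_bound hb.aestronglyMeasurable 1 (ae_of_all _ fun ω => (hb1 ω).le)
  have habi : Integrable (fun ω => a ω * b ω) P :=
    .of_bound (ha.mul hb).aestronglyMeasurable 1
      (ae_of_all _ fun ω => by rw [norm_mul, ha1, hb1, one_mul])
  have hsub : ∀ c : ℂ, ‖c‖ = 1 → ‖c - 1‖ ≤ 2 := fun c hc =>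
    (norm_sub_le _ _).trans (by rw [hc, norm_one]; norm_num)
  have h1 : ∫ ω, (a ω - 1) * (b ω - 1) ∂P =
      ∫ ω, a ω * b ω ∂P - ∫ ω, a ω ∂P - ∫ ω, b ω ∂P + 1 := by
    have : ∀ ω, (a ω - 1) * (b ω - 1) = a ω * b ω - a ω - b ω + 1 := fun ω => by ring
    simp_rw [this]
    have hi₁ : Integrable (fun ω => a ω * b ω - a ω) P := habi.sub hai
    have hi₂ : Integrable (fun ω => a ω * b ω - a ω - b ω) P := hi₁.sub hbi
    rw [integral_add hi₂ (integrable_const _), integral_sub hi₁ hbi, integral_sub habi hai]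
    simp
  have h2 : ∫ ω, (a ω - 1) ∂P = ∫ ω, a ω ∂P - 1 := by
    rw [integral_sub hai (integrable_const _)]
    simp
  have h3 : ∫ ω, (b ω - 1) ∂P = ∫ ω, b ω ∂P - 1 := by
    rw [integral_sub hbi (integrable_const _)]
    simp
  have heq : ∫ ω, a ω * b ω ∂P - (∫ ω, a ω ∂P) * ∫ ω, b ω ∂P =
      ∫ ω, (a ω - 1) * (b ω - 1) ∂P - (∫ ω, (a ω - 1) ∂P) * ∫ ω, (b ω - 1) ∂P := by
    rw [h1, h2, h3]
    ring
  rw [heq]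
  refine (norm_sub_le _ _).trans (add_le_add ?_ ?_)
  · refine norm_integral_le_of_eq_zero (hS.union hT) (fun ω => ?_) fun ω hω => ?_
    · rw [norm_mul]
      calc _ ≤ (2 : ℝ) * 2 := mul_le_mul (hsub _ (ha1 ω)) (hsub _ (hb1 ω)) (norm_nonneg _) (by simp)
        _ = 4 := by norm_num
    · rcases hω with h | h
      · rw [haS ω h, sub_self, zero_mul]
      · rw [hbT ω h, sub_self, mul_zero]
  · rw [norm_mul]
    have hS1 := norm_integral_le_of_eq_zero (P := P) hS (fun ω => hsub _ (ha1 ω))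
      fun ω hω => by rw [haS ω hω, sub_self]
    exact mul_le_mul hS1 (norm_integral_le_of_eq_zero hT (fun ω => hsub _ (hb1 ω))
      fun ω hω => by rw [hbT ω hω, sub_self]) (norm_nonneg _) ((norm_nonneg _).trans hS1)

section CharFun

variable {f₁ f₂ : EuclideanSpace ℝ (Fin n) → EuclideanSpace ℝ (Fin d)}

/-- Joint characteristic functions of jump sums of different kinds factorize. -/
lemma IsLevyProcess.integral_exp_jumpSum (hX : IsLevyProcess P X)
    (hc : ∀ ω, IsCadlag (X · ω)) (hfm₁ : Measurable f₁) (hfm₂ : Measurable f₂) (hε : 0 < ε)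
    (hf₁ : ∀ x, ‖x‖ < ε → f₁ x = 0) (hf₂ : ∀ x, ‖x‖ < ε → f₂ x = 0)
    (hd : ∀ x, f₁ x = 0 ∨ f₂ x = 0) {t : ℝ} (ht : 0 < t) (u₁ u₂ : EuclideanSpace ℝ (Fin d)) :
    ∫ ω, cexp (⟪jumpSum f₁ t (X · ω), u₁⟫ * I) * cexp (⟪jumpSum f₂ t (X · ω), u₂⟫ * I) ∂P =
      (∫ ω, cexp (⟪jumpSum f₁ t (X · ω), u₁⟫ * I) ∂P) *
        ∫ ω, cexp (⟪jumpSum f₂ t (X · ω), u₂⟫ * I) ∂P := by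
  have := hX.isProb
  let e : (EuclideanSpace ℝ (Fin n) → EuclideanSpace ℝ (Fin d)) → EuclideanSpace ℝ (Fin d) → ℝ →
    (ℝ → EuclideanSpace ℝ (Fin n)) → ℂ := fun f u h z => cexp (⟪jumpSum f h z, u⟫ * I)
  have hexp : ∀ u : EuclideanSpace ℝ (Fin d), Measurable fun x => cexp (⟪x, u⟫ * I) := by
    fun_prop
  have he₁ : ∀ h, IsPathFunctional h (e f₁ u₁ h) := fun h =>
    (isPathFunctional_jumpSum hfm₁ hε hf₁ le_rfl).comp (hexp u₁)
  have he₂ : ∀ h, IsPathFunctional h (e f₂ u₂ h) := fun h =>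
    (isPathFunctional_jumpSum hfm₂ hε hf₂ le_rfl).comp (hexp u₂)
  have he₁₂ : ∀ h, IsPathFunctional h fun z => e f₁ u₁ h z * e f₂ u₂ h z := fun h =>
    ((he₁ h).prodMk (he₂ h)).comp (φ := fun p : ℂ × ℂ => p.1 * p.2) (by fun_prop)
  have hnorm : ∀ f u h z, ‖e f u h z‖ = 1 := fun f u h z => Complex.norm_exp_ofReal_mul_I _
  have hmul : ∀ f : EuclideanSpace ℝ (Fin n) → EuclideanSpace ℝ (Fin d),
      (∀ x, ‖x‖ < ε → f x = 0) → ∀ (u) (m : ℕ), 0 < m → ∀ ω, e f u t (X · ω) =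
        ∏ k ∈ Finset.range m, e f u (t / m) (shiftPath (k * (t / m)) (X · ω)) := by
    intro f hf u m hm ω
    have hmt : m * (t / m) = t := by field_simp
    have := (hc ω).jumpSum_mul hε hf (by positivity : 0 ≤ t / m) m
    rw [hmt] at this
    simp only [e]
    rw [this, sum_inner, ← Complex.exp_sum, Complex.ofReal_sum, Finset.sum_mul]
  let x₁ : ℕ → ℂ := fun m => ∫ ω, e f₁ u₁ (t / m) (shiftPath 0 (X · ω)) ∂P
  let x₂ : ℕ → ℂ := fun m => ∫ ω, e f₂ u₂ (t / m) (shiftPath 0 (X · ω)) ∂P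
  let x₁₂ : ℕ → ℂ := fun m => ∫ ω, e f₁ u₁ (t / m) (shiftPath 0 (X · ω)) *
    e f₂ u₂ (t / m) (shiftPath 0 (X · ω)) ∂P
  let p₁ : ℕ → ℝ := fun m => P.real {ω | NoJump f₁ (t / m) (shiftPath 0 (X · ω))}
  let p₂ : ℕ → ℝ := fun m => P.real {ω | NoJump f₂ (t / m) (shiftPath 0 (X · ω))}
  let p₁₂ : ℕ → ℝ := fun m => P.real {ω | NoJump f₁ (t / m) (shiftPath 0 (X · ω)) ∨
    NoJump f₂ (t / m) (shiftPath 0 (X · ω))}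
  have hshift := measurable_shiftPath (X := X) le_rfl fun r _ => hX.meas r
  have hcs := fun ω => (hc ω).shiftPath le_rfl
  have hbound : ∀ m : ℕ, ‖x₁₂ m - x₁ m * x₂ m‖ ≤
      4 * (1 - p₁₂ m) + (2 * (1 - p₁ m)) * (2 * (1 - p₂ m)) := by
    intro m
    refine norm_covariance_le ((he₁ _).measurable_comp hshift hcs)
      ((he₂ _).measurable_comp hshift hcs) (fun ω => hnorm _ _ _ _) (fun ω => hnorm _ _ _ _)
      (measurableSet_setOfPred.2
        ((isPathFunctional_noJump hfm₁ hε hf₁ _).measurable_comp hshift hcs))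
      (measurableSet_setOfPred.2
        ((isPathFunctional_noJump hfm₂ hε hf₂ _).measurable_comp hshift hcs))
      (fun ω hω => ?_) fun ω hω => ?_
    · simp [e, NoJump.jumpSum_eq_zero hω]
    · simp [e, NoJump.jumpSum_eq_zero hω]
  have hle : ∀ g : Ω → ℂ, (∀ ω, ‖g ω‖ = 1) → ‖∫ ω, g ω ∂P‖ ≤ 1 := fun g hg =>
    (norm_integral_le_of_norm_le_const (ae_of_all _ fun ω => (hg ω).le)).trans (by simp)
  set D : ℂ := ∫ ω, e f₁ u₁ t (X · ω) * e f₂ u₂ t (X · ω) ∂P -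
    (∫ ω, e f₁ u₁ t (X · ω) ∂P) * ∫ ω, e f₂ u₂ t (X · ω) ∂P with hD
  obtain ⟨C, hC⟩ := hX.exists_mul_prob_jump_le hc hfm₁ hε hf₁ ht
  have hDle : ∀ᶠ m : ℕ in atTop, ‖D‖ ≤ 4 * (m * (1 - p₁₂ m)) + 4 * (C * (1 - p₂ m)) := by
    filter_upwards [hC, eventually_gt_atTop 0] with m hm hm0
    have hh : 0 ≤ t / m := by positivity
    have h₁ : ∫ ω, e f₁ u₁ t (X · ω) ∂P = x₁ m ^ m := by
      simp_rw [hmul f₁ hf₁ u₁ m hm0]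
      exact hX.integral_prod_functional hc (he₁ _) hh m
    have h₂ : ∫ ω, e f₂ u₂ t (X · ω) ∂P = x₂ m ^ m := by
      simp_rw [hmul f₂ hf₂ u₂ m hm0]
      exact hX.integral_prod_functional hc (he₂ _) hh m
    have h₁₂ : ∫ ω, e f₁ u₁ t (X · ω) * e f₂ u₂ t (X · ω) ∂P = x₁₂ m ^ m := by
      simp_rw [hmul f₁ hf₁ u₁ m hm0, hmul f₂ hf₂ u₂ m hm0, ← Finset.prod_mul_distrib]
      exact hX.integral_prod_functional hc (he₁₂ _) hh m
    rw [hD, h₁, h₂, h₁₂, ← mul_pow]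
    have hx₁₂ : ‖x₁₂ m‖ ≤ 1 := hle _ fun ω => by rw [norm_mul, hnorm, hnorm, one_mul]
    have hx : ‖x₁ m * x₂ m‖ ≤ 1 := by
      rw [norm_mul]
      exact mul_le_one₀ (hle _ fun ω => hnorm _ _ _ _) (norm_nonneg _)
        (hle _ fun ω => hnorm _ _ _ _)
    refine (norm_pow_sub_pow_le hx₁₂ hx m).trans
      ((mul_le_mul_of_nonneg_left (hbound m) m.cast_nonneg).trans ?_)
    have hp₂ : 0 ≤ 1 - p₂ m := sub_nonneg.2 measureReal_le_one
    have := mul_le_mul_of_nonneg_right hm hp₂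
    linear_combination 4 * this
  have hlim : Tendsto (fun m : ℕ => 4 * (m * (1 - p₁₂ m)) + 4 * (C * (1 - p₂ m))) atTop (𝓝 0) := by
    have h1 := hX.tendsto_mul_prob_jumps hc hfm₁ hfm₂ hε hf₁ hf₂ hd ht
    have h2 := hX.tendsto_noJump hc hfm₂ hε hf₂ t
    simpa using (h1.const_mul 4).add (((h2.const_sub 1).const_mul C).const_mul 4)
  exact sub_eq_zero.1 (norm_le_zero_iff.1 (ge_of_tendsto hlim hDle))

theorem IsLevyProcess.indepFun_jumpSum (hX : IsLevyProcess P X)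
    (hc : ∀ ω, IsCadlag (X · ω)) (hfm₁ : Measurable f₁) (hfm₂ : Measurable f₂) (hε : 0 < ε)
    (hf₁ : ∀ x, ‖x‖ < ε → f₁ x = 0) (hf₂ : ∀ x, ‖x‖ < ε → f₂ x = 0)
    (hd : ∀ x, f₁ x = 0 ∨ f₂ x = 0) {t : ℝ} (ht : 0 < t) :
    IndepFun (fun ω => jumpSum f₁ t (X · ω)) (fun ω => jumpSum f₂ t (X · ω)) P := by
  have := hX.isProb
  have hm₁ := measurable_jumpSum hc (fun r _ => hX.meas r) hfm₁ hε hf₁ t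
  have hm₂ := measurable_jumpSum hc (fun r _ => hX.meas r) hfm₂ hε hf₂ t
  rw [indepFun_iff_charFun_prod hm₁.aemeasurable hm₂.aemeasurable]
  intro u
  simp only [charFun_apply]
  have hm₁₂ : Measurable fun ω => WithLp.toLp 2 (jumpSum f₁ t (X · ω), jumpSum f₂ t (X · ω)) :=
    (WithLp.measurable_toLp 2 _).comp (hm₁.prodMk hm₂)
  rw [integral_map hm₁₂.aemeasurable (by fun_prop),
    integral_map hm₁.aemeasurable (by fun_prop), integral_map hm₂.aemeasurable (by fun_prop),
    ← hX.integral_exp_jumpSum hc hfm₁ hfm₂ hε hf₁ hf₂ hd ht]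
  refine integral_congr_ae (ae_of_all _ fun ω => ?_)
  simp [← Complex.exp_add, add_mul]


/-- Jump sums of different kinds form independent processes. -/
theorem IsLevyProcess.indepFun_jumpSum_process (hX : IsLevyProcess P X)
    (hc : ∀ ω, IsCadlag (X · ω)) (hfm₁ : Measurable f₁) (hfm₂ : Measurable f₂) (hε : 0 < ε)
    (hf₁ : ∀ x, ‖x‖ < ε → f₁ x = 0) (hf₂ : ∀ x, ‖x‖ < ε → f₂ x = 0)
    (hd : ∀ x, f₁ x = 0 ∨ f₂ x = 0) :
    IndepFun (fun ω t => jumpSum f₁ t (X · ω)) (fun ω t => jumpSum f₂ t (X · ω)) P := by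
  have := hX.isProb
  have hm₁ := measurable_jumpSum hc (fun r _ => hX.meas r) hfm₁ hε hf₁
  have hm₂ := measurable_jumpSum hc (fun r _ => hX.meas r) hfm₂ hε hf₂
  have hpast : ∀ t, pastSigma X t ≤ ‹MeasurableSpace Ω› := fun t =>
    pastSigma_le fun r _ _ => hX.meas r
  have hF₁ : ∀ h, IsPathFunctional h (jumpSum f₁ h) := fun h =>
    isPathFunctional_jumpSum hfm₁ hε hf₁ le_rfl
  have hF₂ : ∀ h, IsPathFunctional h (jumpSum f₂ h) := fun h =>
    isPathFunctional_jumpSum hfm₂ hε hf₂ le_rfl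
  have hs₁ : ∀ s h : ℝ, 0 ≤ s → Measurable fun ω => jumpSum f₁ h (shiftPath s (X · ω)) :=
    fun s h hs => (hF₁ h).measurable_comp (measurable_shiftPath hs fun r _ => hX.meas r)
      fun ω => (hc ω).shiftPath hs
  have hs₂ : ∀ s h : ℝ, 0 ≤ s → Measurable fun ω => jumpSum f₂ h (shiftPath s (X · ω)) :=
    fun s h hs => (hF₂ h).measurable_comp (measurable_shiftPath hs fun r _ => hX.meas r)
      fun ω => (hc ω).shiftPath hs
  have hinc : ∀ s h : ℝ, 0 ≤ s → IndepFun (fun ω => jumpSum f₁ h (shiftPath s (X · ω)))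
      (fun ω => jumpSum f₂ h (shiftPath s (X · ω))) P := by
    intro s h hs
    rcases le_or_gt h 0 with hh | hh
    · simp_rw [jumpSum_of_nonpos f₁ hh]
      exact indepFun_const_left _ _
    rw [indepFun_iff_map_prod_eq_prod_map_map (hs₁ s h hs).aemeasurable (hs₂ s h hs).aemeasurable,
      hX.map_functional hc ((hF₁ h).prodMk (hF₂ h)) hs, hX.map_functional hc (hF₁ h) hs,
      hX.map_functional hc (hF₂ h) hs]
    simp only [(hc _).jumpSum_shiftPath_zero]
    exact (indepFun_iff_map_prod_eq_prod_map_map (hm₁ h).aemeasurable (hm₂ h).aemeasurable).1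
      (hX.indepFun_jumpSum hc hfm₁ hfm₂ hε hf₁ hf₂ hd hh)
  let A : (EuclideanSpace ℝ (Fin n) → EuclideanSpace ℝ (Fin d)) → NNReal → MeasurableSpace Ω :=
    fun f t => MeasurableSpace.comap (fun ω => jumpSum f t (X · ω)) inferInstance
  let W : (EuclideanSpace ℝ (Fin n) → EuclideanSpace ℝ (Fin d)) → NNReal → NNReal →
      MeasurableSpace Ω := fun f s t =>
    MeasurableSpace.comap (fun ω => jumpSum f (t - s) (shiftPath s (X · ω))) inferInstance
  have hstep : ∀ f : EuclideanSpace ℝ (Fin n) → EuclideanSpace ℝ (Fin d),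
      (∀ x, ‖x‖ < ε → f x = 0) → ∀ s t, s ≤ t → A f t ≤ A f s ⊔ W f s t := by
    intro f hf s t hst
    have hst' : (0 : ℝ) ≤ t - s := sub_nonneg.2 (by exact_mod_cast hst)
    have heq : (fun ω => jumpSum f t (X · ω)) =
        fun ω => jumpSum f s (X · ω) + jumpSum f (t - s) (shiftPath s (X · ω)) := by
      ext1 ω
      rw [← (hc ω).jumpSum_add_time hε hf hst' s.coe_nonneg, add_sub_cancel]
    change MeasurableSpace.comap (fun ω => jumpSum f t (X · ω)) _ ≤ _
    rw [heq]
    exact Measurable.comap_le (((comap_measurable _).mono le_sup_left le_rfl).add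
      ((comap_measurable _).mono le_sup_right le_rfl))
  have hproc : ∀ f : EuclideanSpace ℝ (Fin n) → EuclideanSpace ℝ (Fin d),
      MeasurableSpace.comap (fun ω t => jumpSum f t (X · ω)) inferInstance ≤ ⨆ t, A f t := by
    intro f
    refine comap_pi_le fun r => ?_
    rcases le_or_gt r 0 with hr | hr
    · simp_rw [jumpSum_of_nonpos f hr]
      exact measurable_const
    · exact (comap_measurable _).mono (le_iSup (A f) ⟨r, hr.le⟩) le_rfl
  have hApast : ∀ f : EuclideanSpace ℝ (Fin n) → EuclideanSpace ℝ (Fin d), Measurable f →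
      (∀ x, ‖x‖ < ε → f x = 0) → ∀ r s : NNReal, r ≤ s → A f r ≤ pastSigma X s := by
    intro f hfm hf r s hrs
    refine le_trans ?_ (pastSigma_jumpSum_le hc hfm hε hf s.coe_nonneg)
    exact (measurable_pastSigma (fun r ω => jumpSum f r (X · ω)) r.coe_nonneg
      (by exact_mod_cast hrs)).comap_le
  rw [IndepFun_iff_Indep]
  refine indep_of_indep_of_le (indep_iSup_of_increments (A₁ := A f₁) (A₂ := A f₂) (W₁ := W f₁)
    (W₂ := W f₂) (fun t => (hm₁ t).comap_le) (fun t => (hm₂ t).comap_le)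
    (fun s t => (hs₁ s _ s.coe_nonneg).comap_le) (fun s t => (hs₂ s _ s.coe_nonneg).comap_le)
    (hstep f₁ hf₁) (hstep f₂ hf₂) ?_ (fun s t _ => hinc s (t - s) s.coe_nonneg)
    fun s t _ => ?_) (hproc f₁) (hproc f₂)
  · have : A f₁ 0 = ⊥ := by
      change MeasurableSpace.comap (fun ω => jumpSum f₁ ((0 : NNReal) : ℝ) (X · ω)) _ = ⊥
      simp_rw [NNReal.coe_zero, jumpSum_of_nonpos f₁ le_rfl]
      exact MeasurableSpace.comap_const _
    rw [this]
    exact indep_bot_left _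
  · have hpair := hX.indep_functional hc ((hF₁ (t - s)).prodMk (hF₂ (t - s))) s.coe_nonneg
    refine indep_of_indep_of_le hpair.symm (iSup₂_le fun r hr =>
      sup_le (hApast f₁ hfm₁ hf₁ r s hr) (hApast f₂ hfm₂ hf₂ r s hr)) (sup_le ?_ ?_)
    · exact (measurable_fst.comp (comap_measurable fun ω =>
        (jumpSum f₁ (t - s) (shiftPath s (X · ω)),
          jumpSum f₂ (t - s) (shiftPath s (X · ω))))).comap_le
    · exact (measurable_snd.comp (comap_measurable fun ω =>
        (jumpSum f₁ (t - s) (shiftPath s (X · ω)),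
          jumpSum f₂ (t - s) (shiftPath s (X · ω))))).comap_le

end CharFun

end Factorization

/-- for disjoint Borel sets `B₁, B₂` bounded away from `0`, the
jump processes `X_t(B₁)` and `X_t(B₂)` are independent Lévy processes. -/
theorem jump_processes_independent {Ω : Type*} [MeasurableSpace Ω] (P : Measure Ω) {n : ℕ}
    (X Xm : ℝ → Ω → EuclideanSpace ℝ (Fin n)) (hX : IsLevyProcess P X)
    (hrc : ∀ ω, ∀ t : ℝ, 0 ≤ t → ContinuousWithinAt (fun s => X s ω) (Set.Ici t) t)
    (hll : ∀ ω, ∀ t : ℝ, 0 < t →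
      Tendsto (fun s => X s ω) (𝓝[Set.Iio t] t) (𝓝 (Xm t ω)))
    (B₁ B₂ : Set (EuclideanSpace ℝ (Fin n)))
    (hB₁ : MeasurableSet B₁) (hB₂ : MeasurableSet B₂)
    (hdisj : Disjoint B₁ B₂)
    (h0 : (0 : EuclideanSpace ℝ (Fin n)) ∉ closure B₁ ∪ closure B₂) :
    letI XB : Set (EuclideanSpace ℝ (Fin n)) → ℝ → Ω → EuclideanSpace ℝ (Fin n) :=
      fun B t ω =>
        ∑ᶠ s ∈ {s : ℝ | 0 < s ∧ s ≤ t ∧ X s ω - Xm s ω ∈ B}, (X s ω - Xm s ω)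
    IsLevyProcess P (XB B₁) ∧ IsLevyProcess P (XB B₂) ∧
    IndepFun (fun ω => (fun t : ℝ => XB B₁ t ω)) (fun ω => (fun t : ℝ => XB B₂ t ω)) P := by
  have hc : ∀ ω, IsCadlag (X · ω) := fun ω => ⟨hrc ω, fun t ht => ⟨_, hll ω t ht⟩⟩
  have hsum : ∀ B : Set (EuclideanSpace ℝ (Fin n)), ∀ t ω,
      ∑ᶠ s ∈ {s : ℝ | 0 < s ∧ s ≤ t ∧ X s ω - Xm s ω ∈ B}, (X s ω - Xm s ω) =
        jumpSum (B.indicator id) t (X · ω) := by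
    intro B t ω
    classical
    refine finsum_congr fun s => ?_
    by_cases hs : s ∈ Set.Ioc 0 t
    · have hj : jump (X · ω) s = X s ω - Xm s ω := jump_eq_of_tendsto (hll ω s hs.1)
      rw [finsum_eq_if, finsum_eq_if, hj, if_pos hs, Set.indicator_apply]
      have : s ∈ {s : ℝ | 0 < s ∧ s ≤ t ∧ X s ω - Xm s ω ∈ B} ↔ X s ω - Xm s ω ∈ B :=
        ⟨fun h => h.2.2, fun h => ⟨hs.1, hs.2, h⟩⟩
      simp only [this, id]
    · have : s ∉ {s : ℝ | 0 < s ∧ s ≤ t ∧ X s ω - Xm s ω ∈ B} := fun h => hs ⟨h.1, h.2.1⟩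
      simp [hs, this]
  simp only [hsum]
  rw [← closure_union] at h0
  obtain ⟨ε, hε, hball⟩ := Metric.isOpen_iff.1 isClosed_closure.isOpen_compl _ h0
  have hvanish : ∀ B ⊆ B₁ ∪ B₂, ∀ x, ‖x‖ < ε → B.indicator id x = 0 := fun B hB x hx =>
    Set.indicator_of_notMem
      (fun hxB => hball (mem_ball_zero_iff.2 hx) (subset_closure (hB hxB))) _
  have hf₁ := hvanish B₁ Set.subset_union_left
  have hf₂ := hvanish B₂ Set.subset_union_right
  have hfm₁ := measurable_id.indicator hB₁
  have hfm₂ := measurable_id.indicator hB₂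
  refine ⟨hX.isLevyProcess_jumpSum hc hfm₁ hε hf₁, hX.isLevyProcess_jumpSum hc hfm₂ hε hf₂,
    hX.indepFun_jumpSum_process hc hfm₁ hfm₂ hε hf₁ hf₂ fun x => ?_⟩
  by_cases hx : x ∈ B₁
  · exact Or.inr (Set.indicator_of_notMem (Set.disjoint_left.1 hdisj hx) _)
  · exact Or.inl (Set.indicator_of_notMem hx _)
end
end

section
/- Let B be a one-dimensional centered Lévy process with continuous sample paths. Then there exists σ² ≥ 0 such that E[exp(iuB_t)] = exp(−u²σ²t/2) for all u ∈ ℝ and t ≥ 0; i.e. every continuous centered Lévy process is a Brownian motion. -/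
open MeasureTheory ProbabilityTheory Complex Filter Topology
open scoped ENNReal

noncomputable section

/-- A real-valued Lévy process: `X₀ = 0` a.s., stationary increments independent of
the past, continuity in probability. -/
structure IsLevyR {Ω : Type*} [MeasurableSpace Ω] (P : Measure Ω)
    (X : ℝ → Ω → ℝ) : Prop where
  isProb : IsProbabilityMeasure P
  meas : ∀ t : ℝ, Measurable (X t)
  init : ∀ᵐ ω ∂P, X 0 ω = 0
  indep : ∀ s t : ℝ, 0 ≤ s → 0 ≤ t →
    IndepFun (fun ω => X (t + s) ω - X t ω)
      (fun ω => (fun r : {r : ℝ // 0 ≤ r ∧ r ≤ t} => X r ω)) P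
  stat : ∀ s t : ℝ, 0 ≤ s → 0 ≤ t →
    Measure.map (fun ω => X (t + s) ω - X t ω) P = Measure.map (X s) P
  contProb : ∀ t : ℝ, 0 ≤ t → ∀ ε : ℝ, 0 < ε →
    Tendsto (fun s : ℝ => P {ω | ε ≤ |X s ω - X t ω|}) (𝓝[Set.Ici 0] t) (𝓝 0)

/-- A Poisson process: an increasing, `ℕ`-valued Lévy process, right-continuous,
which grows only by jumps of amplitude 1 (`Nm` is its left-limit process). -/
structure IsPoissonPath {Ω : Type*} [MeasurableSpace Ω] (P : Measure Ω)
    (N Nm : ℝ → Ω → ℝ) : Prop where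
  levy : IsLevyR P N
  mono : ∀ ω, ∀ s t : ℝ, 0 ≤ s → s ≤ t → N s ω ≤ N t ω
  natValued : ∀ ω, ∀ t : ℝ, 0 ≤ t → ∃ k : ℕ, N t ω = (k : ℝ)
  rc : ∀ ω, ∀ t : ℝ, 0 ≤ t → ContinuousWithinAt (fun s => N s ω) (Set.Ici t) t
  leftLim : ∀ ω, ∀ t : ℝ, 0 < t → Tendsto (fun s => N s ω) (𝓝[Set.Iio t] t) (𝓝 (Nm t ω))
  unitJumps : ∀ ω, ∀ t : ℝ, 0 < t → N t ω - Nm t ω = 0 ∨ N t ω - Nm t ω = 1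

/-- A continuous solution of the Cauchy multiplicative equation on `[0, ∞)` is an exponential. -/
theorem exists_eq_exp_of_continuous_of_mul {f : ℝ → ℂ} (hf : Continuous f) (h0 : f 0 = 1)
    (hmul : ∀ s t : ℝ, 0 ≤ s → 0 ≤ t → f (t + s) = f s * f t) :
    ∃ c : ℂ, ∀ t : ℝ, 0 ≤ t → f t = exp (t * c) := by
  set g : ℝ → ℂ := fun t => ∫ x in (0 : ℝ)..t, f x with hg
  have hgd : ∀ t, HasDerivAt g (f t) t := fun t =>
    intervalIntegral.integral_hasDerivAt_right (hf.intervalIntegrable _ _)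
      (hf.stronglyMeasurableAtFilter _ _) hf.continuousAt
  obtain ⟨δ, hδ, hgδ⟩ : ∃ δ : ℝ, 0 < δ ∧ g δ ≠ 0 := by
    have h1 := (hgd 0).tendsto_slope_zero_right
    rw [h0] at h1
    have h2 := (h1.eventually_ne one_ne_zero).and self_mem_nhdsWithin
    obtain ⟨δ, hne, hpos⟩ := h2.exists
    refine ⟨δ, hpos, fun h => hne ?_⟩
    have hz : g 0 = 0 := by simp [hg]
    simp [h, hz]
  have hshift : ∀ t, 0 ≤ t → g (t + δ) - g t = f t * g δ := by
    intro t ht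
    rw [hg]
    simp only
    rw [intervalIntegral.integral_interval_sub_left (hf.intervalIntegrable _ _)
      (hf.intervalIntegrable _ _), ← intervalIntegral.integral_const_mul]
    have h := intervalIntegral.integral_comp_add_left (a := 0) (b := δ) f t
    rw [add_zero] at h
    rw [← h]
    refine intervalIntegral.integral_congr fun s hs => ?_
    rw [Set.uIcc_of_le hδ.le] at hs
    simp only [hmul s t hs.1 ht, mul_comm]
  set c : ℂ := (f δ - 1) / g δ with hc
  have hfd : ∀ t, 0 ≤ t → HasDerivWithinAt f (c * f t) (Set.Ici t) t := by
    intro t ht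
    have h1 : HasDerivAt (fun t => (g (t + δ) - g t) / g δ) ((f (t + δ) - f t) / g δ) t :=
      (((hgd (t + δ)).comp_add_const t δ).sub (hgd t)).div_const _
    have h2 : (f (t + δ) - f t) / g δ = c * f t := by
      rw [hmul δ t hδ.le ht, hc]; ring
    rw [h2] at h1
    have h3 : ∀ x ∈ Set.Ici t, f x = (g (x + δ) - g x) / g δ := fun x hx => by
      rw [hshift x (ht.trans hx), mul_div_cancel_right₀ _ hgδ]
    exact h1.hasDerivWithinAt.congr h3 (h3 t Set.self_mem_Ici)
  refine ⟨c, fun t ht => ?_⟩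
  have hexp : ∀ x : ℝ, HasDerivAt (fun x : ℝ => exp (-(x * c))) (exp (-(x * c)) * -(1 * c)) x :=
    fun x => (((hasDerivAt_id x).ofReal_comp.mul_const c).neg).cexp
  have hconst := constant_of_has_deriv_right_zero (f := fun x : ℝ => f x * exp (-(x * c)))
    (a := 0) (b := t) (by fun_prop) (fun x hx =>
      ((hfd x hx.1).mul (hexp x).hasDerivWithinAt).congr_deriv (by ring)) t ⟨ht, le_rfl⟩
  simp only [h0, ofReal_zero, zero_mul, neg_zero, exp_zero, mul_one] at hconst
  rw [exp_neg] at hconst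
  exact (mul_inv_eq_one₀ (exp_ne_zero _)).1 hconst

theorem tendsto_nat_mul_exp_inv_mul_sub_one (c : ℂ) :
    Tendsto (fun n : ℕ => (n : ℂ) * (exp ((((n : ℝ)⁻¹ : ℝ) : ℂ) * c) - 1)) atTop (𝓝 c) := by
  have h : HasDerivAt (fun x : ℝ => exp (x * c)) (exp (((0 : ℝ) : ℂ) * c) * (1 * c)) 0 :=
    ((hasDerivAt_id (0 : ℝ)).ofReal_comp.mul_const c).cexp
  have h1 := h.tendsto_slope_zero_right
  have h2 : Tendsto (fun n : ℕ => ((n : ℝ)⁻¹ : ℝ)) atTop (𝓝[>] 0) :=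
    tendsto_inv_atTop_nhdsGT_zero.comp tendsto_natCast_atTop_atTop
  have h3 := h1.comp h2
  simpa [Function.comp_def] using h3

/-- The remainder left after expressing the integrand `exp (iux) - 1` through `sin x`
and `1 - cos x`. -/
def expRemainder (u x : ℝ) : ℂ :=
  exp (u * x * I) - 1 - I * u * Real.sin x + u ^ 2 * (1 - Real.cos x : ℝ)

theorem norm_expRemainder_le (u x : ℝ) : ‖expRemainder u x‖ ≤ 2 + |u| + 2 * u ^ 2 := by
  have h1 : ‖exp (u * x * I)‖ = 1 := by
    rw [← ofReal_mul, norm_exp_ofReal_mul_I]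
  have h2 : ‖I * u * (Real.sin x : ℂ)‖ ≤ |u| := by
    rw [norm_mul, norm_mul, norm_I, one_mul, norm_real, norm_real, Real.norm_eq_abs,
      Real.norm_eq_abs]
    exact mul_le_of_le_one_right (abs_nonneg _) (Real.abs_sin_le_one x)
  have h3 : ‖(u : ℂ) ^ 2 * ((1 - Real.cos x : ℝ) : ℂ)‖ ≤ 2 * u ^ 2 := by
    rw [norm_mul, norm_pow, norm_real, norm_real, Real.norm_eq_abs, Real.norm_eq_abs, sq_abs,
      abs_of_nonneg (by linarith [Real.cos_le_one x])]
    nlinarith [Real.neg_one_le_cos x, sq_nonneg u]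
  unfold expRemainder
  refine (norm_add_le _ _).trans ?_
  have h4 := norm_sub_le (exp (u * x * I) - 1) (I * u * (Real.sin x : ℂ))
  have h5 := norm_sub_le (exp (u * x * I)) 1
  rw [norm_one] at h5
  linarith

theorem norm_exp_mul_I_sub_taylor_le (y : ℝ) :
    ‖exp (y * I) - 1 - y * I + y ^ 2 / 2‖ ≤ |y| ^ 3 * Real.exp |y| := by
  have h := Complex.norm_exp_sub_sum_le_norm_mul_exp (y * I) 3
  have h1 : ‖(y : ℂ) * I‖ = |y| := by simp
  rw [h1] at h
  refine le_trans (le_of_eq ?_) h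
  congr 1
  simp only [Finset.sum_range_succ, Finset.sum_range_zero, mul_pow, I_sq]
  norm_num [Nat.factorial]
  ring

theorem exists_norm_expRemainder_le (u : ℝ) :
    ∃ C : ℝ, 0 ≤ C ∧ ∀ x : ℝ, |x| ≤ 1 → ‖expRemainder u x‖ ≤ C * |x| * (1 - Real.cos x) := by
  refine ⟨4 * (|u| ^ 3 * Real.exp |u| + (|u| + u ^ 2) * Real.exp 1), by positivity,
    fun x hx => ?_⟩
  have hcos : x ^ 2 / 4 ≤ 1 - Real.cos x := by
    have h := (abs_le.1 (Real.cos_bound hx)).2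
    have h4 : |x| ^ 4 ≤ x ^ 2 := by
      rw [← sq_abs x]
      exact pow_le_pow_of_le_one (abs_nonneg x) hx (by norm_num)
    nlinarith [sq_nonneg x]
  set h1 : ℂ := exp (x * I) - 1 - x * I + x ^ 2 / 2 with hh1
  have e : expRemainder u x = (exp ((u * x : ℝ) * I) - 1 - (u * x : ℝ) * I + (u * x : ℝ) ^ 2 / 2)
      - I * u * (h1.im : ℂ) - u ^ 2 * (h1.re : ℂ) := by
    have him : h1.im = Real.sin x - x := by
      rw [hh1, show (x : ℂ) ^ 2 / 2 = ((x ^ 2 / 2 : ℝ) : ℂ) by push_cast; ring]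
      simp [exp_ofReal_mul_I_im, -ofReal_div, -ofReal_pow]
    have hre : h1.re = Real.cos x - 1 + x ^ 2 / 2 := by
      rw [hh1, show (x : ℂ) ^ 2 / 2 = ((x ^ 2 / 2 : ℝ) : ℂ) by push_cast; ring]
      simp [exp_ofReal_mul_I_re, -ofReal_div, -ofReal_pow]
    rw [him, hre, expRemainder]
    push_cast
    ring
  have b1 : ‖h1‖ ≤ |x| ^ 3 * Real.exp 1 := (norm_exp_mul_I_sub_taylor_le x).trans (by gcongr)
  have b2 : ‖exp ((u * x : ℝ) * I) - 1 - (u * x : ℝ) * I + ((u * x : ℝ) : ℂ) ^ 2 / 2‖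
      ≤ |u| ^ 3 * |x| ^ 3 * Real.exp |u| := by
    refine (norm_exp_mul_I_sub_taylor_le (u * x)).trans ?_
    rw [abs_mul, mul_pow]
    gcongr
    exact mul_le_of_le_one_right (abs_nonneg _) hx
  have b3 : ‖I * u * (h1.im : ℂ)‖ ≤ |u| * (|x| ^ 3 * Real.exp 1) := by
    rw [norm_mul, norm_mul, norm_I, one_mul, norm_real, norm_real, Real.norm_eq_abs,
      Real.norm_eq_abs]
    gcongr
    exact (abs_im_le_norm h1).trans b1
  have b4 : ‖(u : ℂ) ^ 2 * (h1.re : ℂ)‖ ≤ u ^ 2 * (|x| ^ 3 * Real.exp 1) := by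
    rw [norm_mul, norm_pow, norm_real, norm_real, Real.norm_eq_abs, Real.norm_eq_abs, sq_abs]
    gcongr
    exact (abs_re_le_norm h1).trans b1
  rw [e]
  calc _ ≤ |u| ^ 3 * |x| ^ 3 * Real.exp |u| + |u| * (|x| ^ 3 * Real.exp 1)
        + u ^ 2 * (|x| ^ 3 * Real.exp 1) := by
        refine (norm_sub_le _ _).trans (add_le_add ((norm_sub_le _ _).trans ?_) b4)
        exact add_le_add b2 b3
    _ = 4 * (|u| ^ 3 * Real.exp |u| + (|u| + u ^ 2) * Real.exp 1) * |x| * (x ^ 2 / 4) := by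
        rw [← sq_abs x]; ring
    _ ≤ _ := by gcongr

theorem continuous_expRemainder (u : ℝ) : Continuous (expRemainder u) := by
  unfold expRemainder
  fun_prop

theorem integrable_exp_mul_I (μ : Measure ℝ) [IsProbabilityMeasure μ] (u : ℝ) :
    Integrable (fun x : ℝ => exp (u * x * I)) μ :=
  Integrable.of_bound (by fun_prop) 1 (ae_of_all _ fun x => by
    rw [← ofReal_mul, norm_exp_ofReal_mul_I])

theorem integrable_sin (μ : Measure ℝ) [IsProbabilityMeasure μ] : Integrable Real.sin μ :=
  Integrable.of_bound (by fun_prop) 1 (ae_of_all _ Real.abs_sin_le_one)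

theorem integrable_cos (μ : Measure ℝ) [IsProbabilityMeasure μ] : Integrable Real.cos μ :=
  Integrable.of_bound (by fun_prop) 1 (ae_of_all _ Real.abs_cos_le_one)

theorem charFun_one_re (μ : Measure ℝ) [IsProbabilityMeasure μ] :
    (charFun μ 1).re = ∫ x, Real.cos x ∂μ := by
  rw [charFun_apply_real, ← RCLike.re_eq_complex_re, ← integral_re (integrable_exp_mul_I μ 1)]
  simp [exp_ofReal_mul_I_re]

theorem charFun_one_im (μ : Measure ℝ) [IsProbabilityMeasure μ] :
    (charFun μ 1).im = ∫ x, Real.sin x ∂μ := by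
  rw [charFun_apply_real, ← RCLike.im_eq_complex_im, ← integral_im (integrable_exp_mul_I μ 1)]
  simp [exp_ofReal_mul_I_im]

theorem integral_one_sub_cos (μ : Measure ℝ) [IsProbabilityMeasure μ] :
    ∫ x, (1 - Real.cos x) ∂μ = -(charFun μ 1 - 1).re := by
  rw [integral_sub (integrable_const _) (integrable_cos μ), ← charFun_one_re]
  simp

theorem integral_expRemainder (μ : Measure ℝ) [IsProbabilityMeasure μ] (u : ℝ) :
    ∫ x, expRemainder u x ∂μ = (charFun μ u - 1) - I * u * ((charFun μ 1 - 1).im : ℂ)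
      - u ^ 2 * ((charFun μ 1 - 1).re : ℂ) := by
  have h1 : Integrable (fun x : ℝ => exp (u * x * I) - 1) μ :=
    (integrable_exp_mul_I μ u).sub (integrable_const _)
  have h2 : Integrable (fun x : ℝ => I * u * (Real.sin x : ℂ)) μ :=
    (integrable_sin μ).ofReal.const_mul _
  have h3 : Integrable (fun x : ℝ => (u : ℂ) ^ 2 * ((1 - Real.cos x : ℝ) : ℂ)) μ :=
    ((integrable_const _).sub (integrable_cos μ)).ofReal.const_mul _
  unfold expRemainder
  rw [integral_add (f := fun x : ℝ => exp (u * x * I) - 1 - I * u * (Real.sin x : ℂ))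
      (h1.sub h2) h3, integral_sub h1 h2,
    integral_sub (integrable_exp_mul_I μ u) (integrable_const _), integral_const_mul,
    integral_const_mul, integral_complex_ofReal, integral_complex_ofReal, integral_one_sub_cos,
    ← charFun_one_im, ← charFun_apply_real]
  simp
  ring

/-- In a null array with negligible large values, the limiting characteristic exponent is a
quadratic polynomial. -/
theorem limit_charFun_sub_one_eq {μ : ℕ → Measure ℝ} [∀ n, IsProbabilityMeasure (μ n)]
    (hsmall : ∀ ε : ℝ, 0 < ε →
      Tendsto (fun n : ℕ => (n : ℝ) * (μ n).real {x | ε < |x|}) atTop (𝓝 0))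
    {c : ℝ → ℂ}
    (hc : ∀ u, Tendsto (fun n : ℕ => (n : ℂ) * (charFun (μ n) u - 1)) atTop (𝓝 (c u))) (u : ℝ) :
    c u = I * u * ((c 1).im : ℂ) + u ^ 2 * ((c 1).re : ℂ) := by
  obtain ⟨C, hC0, hC⟩ := exists_norm_expRemainder_le u
  set K : ℝ := 2 + |u| + 2 * u ^ 2 with hK
  have hK0 : 0 ≤ K := by positivity
  have hre : Tendsto (fun n : ℕ => (n : ℝ) * (charFun (μ n) 1 - 1).re) atTop (𝓝 (c 1).re) := by
    refine ((continuous_re.tendsto _).comp (hc 1)).congr fun n => ?_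
    rw [Function.comp_apply, ← ofReal_natCast, re_ofReal_mul]
  have him : Tendsto (fun n : ℕ => (n : ℝ) * (charFun (μ n) 1 - 1).im) atTop (𝓝 (c 1).im) := by
    refine ((continuous_im.tendsto _).comp (hc 1)).congr fun n => ?_
    rw [Function.comp_apply, ← ofReal_natCast, im_ofReal_mul]
  have hlim : Tendsto (fun n : ℕ => (n : ℂ) * ∫ x, expRemainder u x ∂μ n) atTop
      (𝓝 (c u - I * u * ((c 1).im : ℂ) - u ^ 2 * ((c 1).re : ℂ))) := by
    have h := ((hc u).sub (((continuous_ofReal.tendsto _).comp him).const_mul (I * u))).sub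
      (((continuous_ofReal.tendsto _).comp hre).const_mul ((u : ℂ) ^ 2))
    refine h.congr fun n => ?_
    rw [integral_expRemainder]
    simp only [Function.comp, ofReal_mul, ofReal_natCast]
    ring
  have hbound : ∀ ε : ℝ, 0 < ε → ε ≤ 1 →
      ‖c u - I * u * ((c 1).im : ℂ) - u ^ 2 * ((c 1).re : ℂ)‖ ≤ C * ε * -(c 1).re := by
    intro ε hε hε1
    have hR : Tendsto (fun n : ℕ => C * ε * -((n : ℝ) * (charFun (μ n) 1 - 1).re)
        + K * ((n : ℝ) * (μ n).real {x | ε < |x|})) atTop (𝓝 (C * ε * -(c 1).re + K * 0)) :=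
      (hre.neg.const_mul _).add ((hsmall ε hε).const_mul K)
    rw [mul_zero, add_zero] at hR
    refine le_of_tendsto_of_tendsto' hlim.norm hR fun n => ?_
    have hms : MeasurableSet {x : ℝ | ε < |x|} := measurableSet_lt measurable_const (by fun_prop)
    have hi1 : Integrable (fun x => C * ε * (1 - Real.cos x)) (μ n) :=
      ((integrable_const _).sub (integrable_cos _)).const_mul _
    have hi2 : Integrable ({x : ℝ | ε < |x|}.indicator fun _ => K) (μ n) :=
      (integrable_const _).indicator hms
    have hint : ‖∫ x, expRemainder u x ∂μ n‖
        ≤ C * ε * -(charFun (μ n) 1 - 1).re + K * (μ n).real {x | ε < |x|} := by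
      calc ‖∫ x, expRemainder u x ∂μ n‖
          ≤ ∫ x, (C * ε * (1 - Real.cos x) + {x : ℝ | ε < |x|}.indicator (fun _ => K) x) ∂μ n := by
            refine norm_integral_le_of_norm_le (hi1.add hi2) (ae_of_all _ fun x => ?_)
            have hcos : 0 ≤ 1 - Real.cos x := by linarith [Real.cos_le_one x]
            by_cases hx : ε < |x|
            · rw [Set.indicator_of_mem (by exact hx)]
              exact (norm_expRemainder_le u x).trans (le_add_of_nonneg_left (by positivity))
            · rw [Set.indicator_of_notMem (by exact hx), add_zero]
              rw [not_lt] at hx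
              exact (hC x (hx.trans hε1)).trans (by gcongr)
        _ = _ := by
            rw [integral_add hi1 hi2, integral_const_mul, integral_one_sub_cos,
              integral_indicator_const _ hms, smul_eq_mul, mul_comm K]
    rw [norm_mul, Complex.norm_natCast]
    calc (n : ℝ) * ‖∫ x, expRemainder u x ∂μ n‖
        ≤ n * (C * ε * -(charFun (μ n) 1 - 1).re + K * (μ n).real {x | ε < |x|}) := by gcongr
      _ = _ := by ring
  have hzero : ‖c u - I * u * ((c 1).im : ℂ) - u ^ 2 * ((c 1).re : ℂ)‖ ≤ 0 := by
    have h0 : Tendsto (fun ε : ℝ => C * ε * -(c 1).re) (𝓝[>] 0) (𝓝 (C * 0 * -(c 1).re)) :=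
      (Continuous.tendsto (by fun_prop) 0).mono_left nhdsWithin_le_nhds
    rw [mul_zero, zero_mul] at h0
    refine ge_of_tendsto h0 ?_
    filter_upwards [Ioc_mem_nhdsGT (zero_lt_one' ℝ)] with ε hε
    exact hbound ε hε.1 hε.2
  have h := norm_le_zero_iff.1 hzero
  linear_combination h

theorem tendsto_mul_one_sub_of_tendsto_pow {q : ℕ → ℝ} (h0 : ∀ n, 0 ≤ q n) (h1 : ∀ n, q n ≤ 1)
    (hq : Tendsto (fun n => q n ^ n) atTop (𝓝 1)) :
    Tendsto (fun n : ℕ => (n : ℝ) * (1 - q n)) atTop (𝓝 0) := by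
  have hinv : Tendsto (fun n => (q n ^ n)⁻¹ - 1) atTop (𝓝 (1⁻¹ - 1)) :=
    (hq.inv₀ one_ne_zero).sub_const 1
  rw [inv_one, sub_self] at hinv
  refine squeeze_zero' (Eventually.of_forall fun n =>
    mul_nonneg n.cast_nonneg (sub_nonneg.2 (h1 n))) ?_ hinv
  filter_upwards [hq.eventually_const_lt zero_lt_one] with n hn
  have hb := one_add_mul_le_pow (by linarith [h1 n] : -2 ≤ 1 - q n) n
  have hp : ((1 + (1 - q n)) * q n) ^ n ≤ 1 :=
    pow_le_one₀ (mul_nonneg (by linarith [h1 n]) (h0 n)) (by nlinarith [sq_nonneg (1 - q n)])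
  rw [mul_pow] at hp
  rw [le_sub_iff_add_le', ← one_div, le_div_iff₀ hn]
  exact (mul_le_mul_of_nonneg_right hb hn.le).trans hp

namespace IsLevyR

variable {Ω : Type*} [MeasurableSpace Ω] {P : Measure Ω} {X : ℝ → Ω → ℝ}

theorem charFun_zero (hX : IsLevyR P X) (u : ℝ) : charFun (P.map (X 0)) u = 1 := by
  have := hX.isProb
  have h : P.map (X 0) = P.map (fun _ => (0 : ℝ)) := Measure.map_congr hX.init
  rw [h, Measure.map_const]
  simp [charFun_dirac]

theorem charFun_add (hX : IsLevyR P X) {s t : ℝ} (hs : 0 ≤ s) (ht : 0 ≤ t) (u : ℝ) :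
    charFun (P.map (X (t + s))) u = charFun (P.map (X s)) u * charFun (P.map (X t)) u := by
  have := hX.isProb
  have hind : IndepFun (fun ω => X (t + s) ω - X t ω) (X t) P :=
    (hX.indep s t hs ht).comp measurable_id
      (measurable_pi_apply (⟨t, ht, le_rfl⟩ : {r : ℝ // 0 ≤ r ∧ r ≤ t}))
  have h := hind.charFun_map_add_eq_mul ((hX.meas _).sub (hX.meas _)).aemeasurable
    (hX.meas t).aemeasurable
  rw [sub_add_cancel] at h
  rw [h, Pi.mul_apply, ← hX.stat s t hs ht]
  rfl

theorem continuous_charFun (hX : IsLevyR P X) (hcont : ∀ ω, Continuous fun t => X t ω) (u : ℝ) :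
    Continuous fun t => charFun (P.map (X t)) u := by
  have := hX.isProb
  have hm := hX.meas
  have h : ∀ t, charFun (P.map (X t)) u = ∫ ω, exp (u * X t ω * I) ∂P := fun t => by
    rw [charFun_apply_real, integral_map (hm t).aemeasurable (by fun_prop)]
  simp_rw [h]
  refine continuous_of_dominated (bound := fun _ => 1) (fun t => ?_)
    (fun t => ae_of_all _ fun ω => ?_) (integrable_const _) (ae_of_all _ fun ω => ?_)
  · have := hm t
    exact (by fun_prop : Measurable fun ω => exp (u * X t ω * I)).aestronglyMeasurable
  · rw [← ofReal_mul, norm_exp_ofReal_mul_I]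
  · have := hcont ω
    fun_prop

theorem measure_forall_abs_increment_le (hX : IsLevyR P X) {h : ℝ} (hh : 0 ≤ h) (ε : ℝ) (k : ℕ) :
    P {ω | ∀ j : Fin k, |X (j * h + h) ω - X (j * h) ω| ≤ ε} = (P.map (X h) {x | |x| ≤ ε}) ^ k := by
  have hm := hX.meas
  have hms : MeasurableSet {x : ℝ | |x| ≤ ε} := measurableSet_le (by fun_prop) measurable_const
  induction k with
  | zero => have := hX.isProb; simp
  | succ k ih =>
    have hk : 0 ≤ (k : ℝ) * h := by positivity
    have hle : ∀ j : Fin k, (j : ℝ) * h + h ≤ k * h := fun j => by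
      have : ((j : ℕ) : ℝ) + 1 ≤ k := by exact_mod_cast j.2
      nlinarith
    have hj : ∀ j : Fin k, 0 ≤ (j : ℝ) * h := fun j => by positivity
    set T : Set ({r : ℝ // 0 ≤ r ∧ r ≤ k * h} → ℝ) :=
      {f | ∀ j : Fin k, |f ⟨j * h + h, add_nonneg (hj j) hh, hle j⟩
        - f ⟨j * h, hj j, (le_add_of_nonneg_right hh).trans (hle j)⟩| ≤ ε} with hT
    have hTm : MeasurableSet T := by
      rw [hT, Set.ofPred_forall]
      exact MeasurableSet.iInter fun j => measurableSet_le (by fun_prop) measurable_const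
    have h1 := (hX.indep h (k * h) hh hk).measure_inter_preimage_eq_mul _ T hms hTm
    have h2 : P ((fun ω => X (k * h + h) ω - X (k * h) ω) ⁻¹' {x | |x| ≤ ε})
        = P.map (X h) {x | |x| ≤ ε} := by
      rw [← hX.stat h (k * h) hh hk, Measure.map_apply (by fun_prop) hms]
    have h3 : {ω | ∀ j : Fin (k + 1), |X (j * h + h) ω - X (j * h) ω| ≤ ε}
        = (fun ω => X (k * h + h) ω - X (k * h) ω) ⁻¹' {x | |x| ≤ ε} ∩
          (fun ω => (fun r : {r : ℝ // 0 ≤ r ∧ r ≤ k * h} => X r ω)) ⁻¹' T := by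
      ext ω
      simp only [hT, Set.mem_ofPred_eq, Set.mem_inter_iff, Set.mem_preimage, Fin.forall_fin_succ',
        Fin.val_castSucc, Fin.val_last]
      exact and_comm
    have h4 : (fun ω => (fun r : {r : ℝ // 0 ≤ r ∧ r ≤ k * h} => X r ω)) ⁻¹' T
        = {ω | ∀ j : Fin k, |X (j * h + h) ω - X (j * h) ω| ≤ ε} := rfl
    rw [h3, h1, h2, h4, ih, pow_succ']

/-- Path continuity makes large values of the increments over `1 / n` of probability `o(1 / n)`. -/
theorem tendsto_nat_mul_measureReal_abs_gt (hX : IsLevyR P X)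
    (hcont : ∀ ω, Continuous fun t => X t ω) {ε : ℝ} (hε : 0 < ε) :
    Tendsto (fun n : ℕ => (n : ℝ) * (P.map (X (n : ℝ)⁻¹)).real {x | ε < |x|}) atTop (𝓝 0) := by
  have := hX.isProb
  have hprob : ∀ t, IsProbabilityMeasure (P.map (X t)) := fun t =>
    Measure.isProbabilityMeasure_map (hX.meas t).aemeasurable
  have hms : MeasurableSet {x : ℝ | |x| ≤ ε} := measurableSet_le (by fun_prop) measurable_const
  set E : ℕ → Set Ω := fun n =>
    {ω | ∀ j : Fin n, |X (j * (n : ℝ)⁻¹ + (n : ℝ)⁻¹) ω - X (j * (n : ℝ)⁻¹) ω| ≤ ε} with hE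
  have hEm : ∀ n, MeasurableSet (E n) := fun n => by
    rw [hE]
    simp only [Set.ofPred_forall]
    exact MeasurableSet.iInter fun j =>
      measurableSet_le ((hX.meas _).sub (hX.meas _)).abs measurable_const
  have hlim : Tendsto (fun n => P (E n)) atTop (𝓝 (P Set.univ)) := by
    refine tendsto_measure_of_tendsto_indicator_of_isFiniteMeasure atTop P hEm fun ω => ?_
    have huc := isCompact_Icc.uniformContinuousOn_of_continuous
      (hcont ω).continuousOn (s := Set.Icc (0 : ℝ) 1)
    obtain ⟨δ, hδ, hd⟩ := Metric.uniformContinuousOn_iff.1 huc ε hε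
    have hsmall := (tendsto_inv_atTop_zero.comp
      (tendsto_natCast_atTop_atTop (R := ℝ))).eventually_lt_const hδ
    filter_upwards [hsmall] with n hn
    simp only [Set.mem_univ, iff_true, hE, Set.mem_ofPred_eq]
    intro j
    have hn0 : (0 : ℝ) < n := by exact_mod_cast j.pos
    have hj : ((j : ℕ) : ℝ) + 1 ≤ n := by exact_mod_cast j.2
    have hj0 : 0 ≤ (j : ℝ) * (n : ℝ)⁻¹ := by positivity
    have hinv : 0 < (n : ℝ)⁻¹ := by positivity
    have hj1 : (j : ℝ) * (n : ℝ)⁻¹ + (n : ℝ)⁻¹ ≤ 1 := by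
      rw [← add_one_mul, ← div_eq_mul_inv, div_le_one hn0]
      exact hj
    have h := hd (j * (n : ℝ)⁻¹ + (n : ℝ)⁻¹) ⟨by linarith, hj1⟩ (j * (n : ℝ)⁻¹)
      ⟨hj0, by linarith⟩ (by
        rw [Real.dist_eq, add_sub_cancel_left, abs_of_pos hinv]
        exact hn)
    rw [Real.dist_eq] at h
    exact h.le
  have hpow : Tendsto (fun n : ℕ => (P.map (X (n : ℝ)⁻¹)).real {x | |x| ≤ ε} ^ n) atTop (𝓝 1) := by
    have h := (ENNReal.tendsto_toReal (measure_ne_top P Set.univ)).comp hlim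
    rw [measure_univ, ENNReal.toReal_one] at h
    refine h.congr fun n => ?_
    rw [Function.comp_apply, hE, hX.measure_forall_abs_increment_le (by positivity) ε n,
      ENNReal.toReal_pow, Measure.real]
  refine (tendsto_mul_one_sub_of_tendsto_pow (fun n => measureReal_nonneg)
    (fun n => measureReal_le_one) hpow).congr fun n => ?_
  rw [← probReal_compl_eq_one_sub hms]
  congr 2
  ext x
  simp

end IsLevyR

/-- a one-dimensional centered Lévy process with continuous sample
paths is a Brownian motion: `E[exp(iuB_t)] = exp(-u²σ²t/2)` for some `σ² ≥ 0`. -/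
theorem continuous_centered_levy_is_gaussian {Ω : Type*} [MeasurableSpace Ω]
    (P : Measure Ω) (B : ℝ → Ω → ℝ) (hB : IsLevyR P B)
    (hcont : ∀ ω, Continuous fun t => B t ω)
    (hint : ∀ t : ℝ, 0 ≤ t → Integrable (B t) P)
    (hcentered : ∀ t : ℝ, 0 ≤ t → ∫ ω, B t ω ∂P = 0) :
    ∃ σ2 : ℝ, 0 ≤ σ2 ∧ ∀ u : ℝ, ∀ t : ℝ, 0 ≤ t →
      ∫ ω, Complex.exp (Complex.I * u * (B t ω : ℝ)) ∂P
        = Complex.exp (-(u ^ 2 * σ2 * t : ℂ) / 2) := by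
  have := hB.isProb
  have hprob : ∀ t, IsProbabilityMeasure (P.map (B t)) := fun t =>
    Measure.isProbabilityMeasure_map (hB.meas t).aemeasurable
  choose c hc using fun u => exists_eq_exp_of_continuous_of_mul (hB.continuous_charFun hcont u)
    (hB.charFun_zero u) (fun s t hs ht => hB.charFun_add hs ht u)
  have hlim : ∀ u, Tendsto (fun n : ℕ => (n : ℂ) * (charFun (P.map (B (n : ℝ)⁻¹)) u - 1)) atTop
      (𝓝 (c u)) := fun u =>
    (tendsto_nat_mul_exp_inv_mul_sub_one (c u)).congr fun n => by rw [hc u _ (by positivity)]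
  have hquad := limit_charFun_sub_one_eq
    (fun ε hε => hB.tendsto_nat_mul_measureReal_abs_gt hcont hε) hlim
  have hre : (c 1).re ≤ 0 := by
    have h1 := norm_charFun_le_one (μ := P.map (B 1)) (1 : ℝ)
    rw [hc 1 1 zero_le_one, norm_exp, Real.exp_le_one_iff] at h1
    simpa using h1
  have him : (c 1).im = 0 := by
    have hg : P.map (B 1) = gaussianReal (c 1).im (-2 * (c 1).re).toNNReal := by
      refine Measure.ext_of_charFun (funext fun u => ?_)
      rw [hc u 1 zero_le_one, charFun_gaussianReal, hquad u, Real.coe_toNNReal _ (by linarith)]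
      congr 1
      push_cast
      ring
    rw [← integral_id_gaussianReal (μ := (c 1).im) (v := (-2 * (c 1).re).toNNReal), ← hg,
      integral_map (hB.meas 1).aemeasurable (by fun_prop), hcentered 1 zero_le_one]
  refine ⟨-2 * (c 1).re, by linarith, fun u t ht => ?_⟩
  have h := hc u t ht
  rw [charFun_apply_real, integral_map (hB.meas t).aemeasurable (by fun_prop), hquad u, him] at h
  convert h using 2
  · ext ω
    congr 1
    ring
  · push_cast
    ring
end
end

section
/- Uniqueness in the Lévy-Khintchine representation: if ψ(u) = Q_j(u)/2 − i⟨a_j,u⟩ + ∫_{|x|≥1}(1 − e^{i⟨u,x⟩})ν_j(dx) + ∫_{|x|<1}(1 − e^{i⟨u,x⟩} + i⟨u,x⟩)ν_j(dx) for j = 1, 2, where Q_j is a non-negative quadratic form, a_j ∈ ℝ^n, and ν_j is a positive measure on ℝ^n∖{0} with ∫(|x|²∧1)dν_j < ∞, then Q₁ = Q₂, a₁ = a₂, and ν₁ = ν₂. -/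
open MeasureTheory Complex Filter Topology
open scoped RealInnerProductSpace ENNReal

noncomputable section

/-- The Lévy-Khintchine exponent associated with a quadratic form `Q`, a drift `a`
and a Lévy measure `ν`. -/
def lkExponent {n : ℕ} (Q : QuadraticForm ℝ (EuclideanSpace ℝ (Fin n)))
    (a : EuclideanSpace ℝ (Fin n)) (ν : Measure (EuclideanSpace ℝ (Fin n)))
    (u : EuclideanSpace ℝ (Fin n)) : ℂ :=
  (Q u / 2 : ℝ) - Complex.I * (⟪a, u⟫ : ℝ)
    + ∫ x in {x : EuclideanSpace ℝ (Fin n) | 1 ≤ ‖x‖},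
        (1 - Complex.exp (Complex.I * (⟪u, x⟫ : ℝ))) ∂ν
    + ∫ x in {x : EuclideanSpace ℝ (Fin n) | ‖x‖ < 1},
        (1 - Complex.exp (Complex.I * (⟪u, x⟫ : ℝ)) + Complex.I * (⟪u, x⟫ : ℝ)) ∂ν

/-- The density of the finite measure read off from the second difference of a Lévy-Khintchine
exponent in the direction `w`. -/
def secondDiffDensity {n : ℕ} (w x : EuclideanSpace ℝ (Fin n)) : ℝ :=
  2 * (1 - Real.cos ⟪w, x⟫)

lemma secondDiffDensity_nonneg {n : ℕ} (w x : EuclideanSpace ℝ (Fin n)) :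
    0 ≤ secondDiffDensity w x := by
  have := Real.cos_le_one ⟪w, x⟫
  unfold secondDiffDensity
  linarith

lemma continuous_secondDiffDensity {n : ℕ} (w : EuclideanSpace ℝ (Fin n)) :
    Continuous (secondDiffDensity w) := by
  unfold secondDiffDensity
  fun_prop

lemma norm_one_sub_exp_I_mul_le (t : ℝ) : ‖1 - exp (I * t)‖ ≤ 2 := by
  refine (norm_sub_le _ _).trans ?_
  rw [norm_exp_I_mul_ofReal, norm_one]
  norm_num

lemma norm_one_sub_exp_I_mul_add_le (t : ℝ) : ‖1 - exp (I * t) + I * t‖ ≤ 3 * t ^ 2 := by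
  have hnorm : ‖I * (t : ℂ)‖ = |t| := by simp
  rcases le_or_gt |t| 1 with ht | ht
  · have h := norm_exp_sub_one_sub_id_le (x := I * (t : ℂ)) (by rwa [hnorm])
    rw [hnorm, sq_abs] at h
    calc ‖1 - exp (I * t) + I * t‖ = ‖exp (I * t) - 1 - I * t‖ := by
          rw [← norm_neg]; congr 1; ring
      _ ≤ 3 * t ^ 2 := by nlinarith [sq_nonneg t]
  · have h := norm_add_le (1 - exp (I * t)) (I * t)
    rw [hnorm] at h
    nlinarith [norm_one_sub_exp_I_mul_le t, sq_abs t]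

section LevyMeasure

variable {n : ℕ} {ν : Measure (EuclideanSpace ℝ (Fin n))}

lemma integrable_min_norm_sq_one (hν : ∫⁻ x, ENNReal.ofReal (min (‖x‖ ^ 2) 1) ∂ν < ⊤) :
    Integrable (fun x : EuclideanSpace ℝ (Fin n) => min (‖x‖ ^ 2) 1) ν := by
  refine ⟨by fun_prop, ?_⟩
  rw [hasFiniteIntegral_iff_ofReal (ae_of_all _ fun x => by positivity)]
  exact hν

lemma setOf_one_le_norm_eq_compl :
    {x : EuclideanSpace ℝ (Fin n) | 1 ≤ ‖x‖} = {x | ‖x‖ < 1}ᶜ := by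
  ext x
  simp

lemma measurableSet_norm_lt_one :
    MeasurableSet {x : EuclideanSpace ℝ (Fin n) | ‖x‖ < 1} :=
  measurableSet_lt measurable_norm measurable_const

lemma measurableSet_one_le_norm :
    MeasurableSet {x : EuclideanSpace ℝ (Fin n) | 1 ≤ ‖x‖} :=
  measurableSet_le measurable_const measurable_norm

lemma integrableOn_one_sub_exp (hν : ∫⁻ x, ENNReal.ofReal (min (‖x‖ ^ 2) 1) ∂ν < ⊤)
    (u : EuclideanSpace ℝ (Fin n)) :
    IntegrableOn (fun x => 1 - exp (I * (⟪u, x⟫ : ℝ))) {x | 1 ≤ ‖x‖} ν := by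
  refine ((integrable_min_norm_sq_one hν).const_mul 2).integrableOn.mono'
    (Continuous.aestronglyMeasurable (by fun_prop)) ?_
  filter_upwards [ae_restrict_mem measurableSet_one_le_norm] with x hx
  rw [min_eq_right (one_le_pow₀ hx), mul_one]
  exact norm_one_sub_exp_I_mul_le _

lemma integrableOn_one_sub_exp_add (hν : ∫⁻ x, ENNReal.ofReal (min (‖x‖ ^ 2) 1) ∂ν < ⊤)
    (u : EuclideanSpace ℝ (Fin n)) :
    IntegrableOn (fun x => 1 - exp (I * (⟪u, x⟫ : ℝ)) + I * (⟪u, x⟫ : ℝ)) {x | ‖x‖ < 1} ν := by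
  refine ((integrable_min_norm_sq_one hν).const_mul (3 * ‖u‖ ^ 2)).integrableOn.mono'
    (Continuous.aestronglyMeasurable (by fun_prop)) ?_
  filter_upwards [ae_restrict_mem measurableSet_norm_lt_one] with x hx
  have hx1 : ‖x‖ ^ 2 ≤ 1 := pow_le_one₀ (norm_nonneg x) (le_of_lt hx)
  rw [min_eq_left hx1]
  refine (norm_one_sub_exp_I_mul_add_le _).trans ?_
  have h := pow_le_pow_left₀ (abs_nonneg _) (abs_real_inner_le_norm u x) 2
  rw [sq_abs, mul_pow] at h
  linarith

lemma exp_second_diff (u w x : EuclideanSpace ℝ (Fin n)) :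
    exp (I * (⟪u, x⟫ : ℝ)) * (secondDiffDensity w x : ℂ)
      = 2 * exp (I * (⟪u, x⟫ : ℝ)) - exp (I * (⟪u + w, x⟫ : ℝ)) - exp (I * (⟪u - w, x⟫ : ℝ)) := by
  have hcos : (2 : ℂ) * ((Real.cos ⟪w, x⟫ : ℝ) : ℂ)
      = exp (I * (⟪w, x⟫ : ℝ)) + exp (-(I * (⟪w, x⟫ : ℝ))) := by
    rw [ofReal_cos, two_cos]
    congr 2 <;> ring
  rw [inner_add_left, inner_sub_left, secondDiffDensity]
  push_cast
  rw [mul_add, mul_sub I, exp_add, sub_eq_add_neg (I * _), exp_add]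
  push_cast at hcos
  linear_combination (-exp (I * (⟪u, x⟫ : ℝ))) * hcos

lemma integrable_secondDiffDensity (hν : ∫⁻ x, ENNReal.ofReal (min (‖x‖ ^ 2) 1) ∂ν < ⊤)
    (w : EuclideanSpace ℝ (Fin n)) : Integrable (secondDiffDensity w) ν := by
  refine ((integrable_min_norm_sq_one hν).const_mul (4 + ‖w‖ ^ 2)).mono'
    (continuous_secondDiffDensity w).aestronglyMeasurable (ae_of_all _ fun x => ?_)
  rw [Real.norm_of_nonneg (secondDiffDensity_nonneg w x), secondDiffDensity]
  rcases le_total (‖x‖ ^ 2) 1 with hx | hx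
  · rw [min_eq_left hx]
    have h := pow_le_pow_left₀ (abs_nonneg _) (abs_real_inner_le_norm w x) 2
    rw [sq_abs, mul_pow] at h
    nlinarith [Real.one_sub_sq_div_two_le_cos (x := ⟪w, x⟫), sq_nonneg ‖x‖]
  · rw [min_eq_right hx]
    nlinarith [Real.neg_one_le_cos ⟪w, x⟫, sq_nonneg ‖w‖]

lemma lkExponent_second_diff (hν : ∫⁻ x, ENNReal.ofReal (min (‖x‖ ^ 2) 1) ∂ν < ⊤)
    (Q : QuadraticForm ℝ (EuclideanSpace ℝ (Fin n))) (a u w : EuclideanSpace ℝ (Fin n)) :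
    lkExponent Q a ν (u + w) + lkExponent Q a ν (u - w) - 2 * lkExponent Q a ν u
      = (Q w : ℂ) + ∫ x, exp (I * (⟪u, x⟫ : ℝ)) * (secondDiffDensity w x : ℂ) ∂ν := by
  have hint : Integrable (fun x => exp (I * (⟪u, x⟫ : ℝ)) * (secondDiffDensity w x : ℂ)) ν := by
    refine (integrable_secondDiffDensity hν w).mono' ?_ (ae_of_all _ fun x => ?_)
    · have := continuous_secondDiffDensity w
      exact Continuous.aestronglyMeasurable (by fun_prop)
    · rw [norm_mul, norm_exp_I_mul_ofReal, one_mul, norm_real,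
        Real.norm_of_nonneg (secondDiffDensity_nonneg w x)]
  have hQ : Q (u + w) + Q (u - w) - 2 * Q u = 2 * Q w := by
    rw [sub_eq_add_neg u w, QuadraticMap.map_add Q, QuadraticMap.map_add Q,
      QuadraticMap.polar_neg_right, QuadraticMap.map_neg]
    ring
  have hQ' : (Q (u + w) : ℂ) + Q (u - w) - 2 * Q u = 2 * Q w := by exact_mod_cast hQ
  have hlarge := integrableOn_one_sub_exp hν
  have hsmall := integrableOn_one_sub_exp_add hν
  rw [← integral_add_compl measurableSet_norm_lt_one hint, ← setOf_one_le_norm_eq_compl]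
  have h₁ : ∫ x in {x | 1 ≤ ‖x‖}, exp (I * (⟪u, x⟫ : ℝ)) * (secondDiffDensity w x : ℂ) ∂ν
      = ∫ x in {x | 1 ≤ ‖x‖}, (1 - exp (I * (⟪u + w, x⟫ : ℝ))) ∂ν
        + ∫ x in {x | 1 ≤ ‖x‖}, (1 - exp (I * (⟪u - w, x⟫ : ℝ))) ∂ν
        - 2 * ∫ x in {x | 1 ≤ ‖x‖}, (1 - exp (I * (⟪u, x⟫ : ℝ))) ∂ν := by
    rw [← integral_add (hlarge _) (hlarge _), ← integral_const_mul,
      ← integral_sub (Integrable.fun_add (hlarge _) (hlarge _)) ((hlarge _).const_mul 2)]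
    refine integral_congr_ae (ae_of_all _ fun x => ?_)
    simp only [exp_second_diff]
    ring
  have h₂ : ∫ x in {x | ‖x‖ < 1}, exp (I * (⟪u, x⟫ : ℝ)) * (secondDiffDensity w x : ℂ) ∂ν
      = ∫ x in {x | ‖x‖ < 1}, (1 - exp (I * (⟪u + w, x⟫ : ℝ)) + I * (⟪u + w, x⟫ : ℝ)) ∂ν
        + ∫ x in {x | ‖x‖ < 1}, (1 - exp (I * (⟪u - w, x⟫ : ℝ)) + I * (⟪u - w, x⟫ : ℝ)) ∂ν
        - 2 * ∫ x in {x | ‖x‖ < 1}, (1 - exp (I * (⟪u, x⟫ : ℝ)) + I * (⟪u, x⟫ : ℝ)) ∂ν := by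
    rw [← integral_add (hsmall _) (hsmall _), ← integral_const_mul,
      ← integral_sub (Integrable.fun_add (hsmall _) (hsmall _)) ((hsmall _).const_mul 2)]
    refine integral_congr_ae (ae_of_all _ fun x => ?_)
    simp only [exp_second_diff]
    rw [inner_add_left, inner_sub_left]
    push_cast
    ring
  rw [h₁, h₂]
  simp only [lkExponent, inner_add_right, inner_sub_right]
  push_cast
  linear_combination (1 / 2 : ℂ) * hQ'

/-- The finite measure whose characteristic function is the second difference of the exponent of
`(Q, a, ν)` in the direction `w`, where `q = Q w`. -/
def secondDiffMeasure (q : ℝ) (ν : Measure (EuclideanSpace ℝ (Fin n)))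
    (w : EuclideanSpace ℝ (Fin n)) : Measure (EuclideanSpace ℝ (Fin n)) :=
  ENNReal.ofReal q • Measure.dirac 0
    + ν.withDensity fun x => ENNReal.ofReal (secondDiffDensity w x)

lemma isFiniteMeasure_secondDiffMeasure
    (hν : ∫⁻ x, ENNReal.ofReal (min (‖x‖ ^ 2) 1) ∂ν < ⊤) (q : ℝ)
    (w : EuclideanSpace ℝ (Fin n)) : IsFiniteMeasure (secondDiffMeasure q ν w) := by
  have := isFiniteMeasure_withDensity_ofReal (integrable_secondDiffDensity hν w).2
  have : IsFiniteMeasure (ENNReal.ofReal q •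
      (Measure.dirac 0 : Measure (EuclideanSpace ℝ (Fin n)))) :=
    Measure.smul_finite _ ENNReal.ofReal_ne_top
  unfold secondDiffMeasure
  infer_instance

lemma charFun_secondDiffMeasure (hν : ∫⁻ x, ENNReal.ofReal (min (‖x‖ ^ 2) 1) ∂ν < ⊤)
    {q : ℝ} (hq : 0 ≤ q) (u w : EuclideanSpace ℝ (Fin n)) :
    charFun (secondDiffMeasure q ν w) u
      = (q : ℂ) + ∫ x, exp (I * (⟪u, x⟫ : ℝ)) * (secondDiffDensity w x : ℂ) ∂ν := by
  have := isFiniteMeasure_secondDiffMeasure hν q w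
  have hint : Integrable (fun x => exp ((⟪x, u⟫ : ℝ) * I)) (secondDiffMeasure q ν w) := by
    refine Integrable.of_bound (Continuous.aestronglyMeasurable (by fun_prop)) 1
      (ae_of_all _ fun x => ?_)
    rw [norm_exp_ofReal_mul_I]
  rw [secondDiffMeasure, integrable_add_measure] at hint
  rw [charFun_apply, secondDiffMeasure, integral_add_measure hint.1 hint.2, integral_smul_measure,
    integral_dirac, ENNReal.toReal_ofReal hq,
    integral_withDensity_eq_integral_toReal_smul
      (continuous_secondDiffDensity w).measurable.ennreal_ofReal
      (ae_of_all _ fun _ => ENNReal.ofReal_lt_top)]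
  congr 1
  · simp
  · refine integral_congr_ae (ae_of_all _ fun x => ?_)
    simp only [ENNReal.toReal_ofReal (secondDiffDensity_nonneg w x), real_smul]
    rw [real_inner_comm, mul_comm I, mul_comm]

lemma secondDiffMeasure_singleton_zero (q : ℝ) (w : EuclideanSpace ℝ (Fin n)) :
    secondDiffMeasure q ν w {0} = ENNReal.ofReal q := by
  simp [secondDiffMeasure, secondDiffDensity]

end LevyMeasure

lemma exists_denseSeq_secondDiffDensity_ne_zero {n : ℕ} {x : EuclideanSpace ℝ (Fin n)}
    (hx : x ≠ 0) :
    ∃ k, secondDiffDensity (TopologicalSpace.denseSeq (EuclideanSpace ℝ (Fin n)) k) x ≠ 0 := by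
  have hopen : IsOpen {w : EuclideanSpace ℝ (Fin n) | secondDiffDensity w x ≠ 0} := by
    refine isOpen_ne_fun ?_ continuous_const
    unfold secondDiffDensity
    fun_prop
  have hne : {w : EuclideanSpace ℝ (Fin n) | secondDiffDensity w x ≠ 0}.Nonempty := by
    refine ⟨(Real.pi / ‖x‖ ^ 2) • x, ?_⟩
    have hx' : ‖x‖ ^ 2 ≠ 0 := by simpa using hx
    have h : ⟪(Real.pi / ‖x‖ ^ 2) • x, x⟫ = Real.pi := by
      rw [real_inner_smul_left, real_inner_self_eq_norm_sq, div_mul_cancel₀ _ hx']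
    simp only [Set.mem_ofPred_eq, secondDiffDensity, h, Real.cos_pi]
    norm_num
  obtain ⟨k, hk⟩ := (TopologicalSpace.denseRange_denseSeq _).exists_mem_open hopen hne
  exact ⟨k, hk⟩

/-- A measure without mass at the origin is determined by its products with the densities
`secondDiffDensity w`. -/
lemma eq_of_withDensity_secondDiffDensity_eq {n : ℕ}
    {ν₁ ν₂ : Measure (EuclideanSpace ℝ (Fin n))} (h₁ : ν₁ {0} = 0) (h₂ : ν₂ {0} = 0)
    (h : ∀ w, ν₁.withDensity (fun x => ENNReal.ofReal (secondDiffDensity w x))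
      = ν₂.withDensity (fun x => ENNReal.ofReal (secondDiffDensity w x))) :
    ν₁ = ν₂ := by
  let s : Option ℕ → Set (EuclideanSpace ℝ (Fin n)) := fun o => o.elim {0} fun k =>
    {x | ENNReal.ofReal (secondDiffDensity (TopologicalSpace.denseSeq _ k) x) ≠ 0}
  refine (Measure.ext_iff_of_iUnion_eq_univ (s := s) ?_).2 ?_
  · refine Set.eq_univ_of_forall fun x => Set.mem_iUnion.2 ?_
    by_cases hx : x = 0
    · exact ⟨none, hx⟩
    · obtain ⟨k, hk⟩ := exists_denseSeq_secondDiffDensity_ne_zero hx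
      refine ⟨some k, ?_⟩
      simpa [s] using lt_of_le_of_ne (secondDiffDensity_nonneg _ _) hk.symm
  · rintro (_ | k)
    · simp only [s, Option.elim]
      rw [Measure.restrict_eq_zero.2 h₁, Measure.restrict_eq_zero.2 h₂]
    · have hm : Measurable fun x => ENNReal.ofReal
          (secondDiffDensity (TopologicalSpace.denseSeq (EuclideanSpace ℝ (Fin n)) k) x) :=
        (continuous_secondDiffDensity _).measurable.ennreal_ofReal
      have hms : MeasurableSet (s (some k)) := hm (measurableSet_singleton 0).compl
      have key (ν : Measure (EuclideanSpace ℝ (Fin n))) : ν.restrict (s (some k))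
          = ((ν.withDensity fun x => ENNReal.ofReal
              (secondDiffDensity (TopologicalSpace.denseSeq _ k) x)).withDensity fun x =>
              (ENNReal.ofReal (secondDiffDensity (TopologicalSpace.denseSeq _ k) x))⁻¹).restrict
              (s (some k)) := by
        rw [← withDensity_mul _ hm hm.fun_inv, restrict_withDensity hms]
        conv_lhs => rw [← withDensity_one (μ := ν.restrict (s (some k)))]
        refine withDensity_congr_ae ?_
        filter_upwards [ae_restrict_mem hms] with x hx
        exact (ENNReal.mul_inv_cancel hx ENNReal.ofReal_ne_top).symm
      rw [key ν₁, key ν₂, h]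

/-- uniqueness of the Lévy-Khintchine representation: the triplet
`(Q, a, ν)` is determined by the exponent `ψ`. -/
theorem levy_khintchine_unique {n : ℕ}
    (Q₁ Q₂ : QuadraticForm ℝ (EuclideanSpace ℝ (Fin n)))
    (hQ₁ : ∀ u, 0 ≤ Q₁ u) (hQ₂ : ∀ u, 0 ≤ Q₂ u)
    (a₁ a₂ : EuclideanSpace ℝ (Fin n))
    (ν₁ ν₂ : Measure (EuclideanSpace ℝ (Fin n)))
    (hν₁0 : ν₁ {0} = 0) (hν₂0 : ν₂ {0} = 0)
    (hν₁int : ∫⁻ x, ENNReal.ofReal (min (‖x‖ ^ 2) 1) ∂ν₁ < ⊤)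
    (hν₂int : ∫⁻ x, ENNReal.ofReal (min (‖x‖ ^ 2) 1) ∂ν₂ < ⊤)
    (heq : ∀ u : EuclideanSpace ℝ (Fin n),
      lkExponent Q₁ a₁ ν₁ u = lkExponent Q₂ a₂ ν₂ u) :
    Q₁ = Q₂ ∧ a₁ = a₂ ∧ ν₁ = ν₂ := by
  have hmeas (w : EuclideanSpace ℝ (Fin n)) :
      secondDiffMeasure (Q₁ w) ν₁ w = secondDiffMeasure (Q₂ w) ν₂ w := by
    have := isFiniteMeasure_secondDiffMeasure hν₁int (Q₁ w) w
    have := isFiniteMeasure_secondDiffMeasure hν₂int (Q₂ w) w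
    refine Measure.ext_of_charFun (funext fun u => ?_)
    rw [charFun_secondDiffMeasure hν₁int (hQ₁ w), charFun_secondDiffMeasure hν₂int (hQ₂ w),
      ← lkExponent_second_diff hν₁int Q₁ a₁, ← lkExponent_second_diff hν₂int Q₂ a₂]
    simp only [heq]
  have hQ : Q₁ = Q₂ := by
    ext w
    have h := congrArg (fun μ : Measure (EuclideanSpace ℝ (Fin n)) => μ {0}) (hmeas w)
    simp only [secondDiffMeasure_singleton_zero] at h
    exact (ENNReal.ofReal_eq_ofReal_iff (hQ₁ w) (hQ₂ w)).1 h
  subst hQ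
  have hν : ν₁ = ν₂ := by
    refine eq_of_withDensity_secondDiffDensity_eq hν₁0 hν₂0 fun w => ?_
    have : IsFiniteMeasure (ENNReal.ofReal (Q₁ w) •
        (Measure.dirac 0 : Measure (EuclideanSpace ℝ (Fin n)))) :=
      Measure.smul_finite _ ENNReal.ofReal_ne_top
    exact (Measure.add_right_inj _ _ _).1 (hmeas w)
  subst hν
  refine ⟨rfl, ext_inner_right ℝ fun u => ?_, rfl⟩
  have h := heq u
  simp only [lkExponent, add_left_inj, sub_right_inj, mul_right_inj' I_ne_zero] at h
  exact_mod_cast h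
end
end
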